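/- For every laminarity-constrained matroid median instance and every fractional solution (x,y), there exists an integral solution whose cost is at most 8 times the cost of (x,y). -/

import Mathlib

open scoped Classical
open Finset

/-- The rank function of a matroid: the maximum cardinality of an independent
subset of the given set. -/
noncomputable def matroidRank {α : Type*} (M : Matroid α) (S : Finset α) : ℕ :=
  (S.powerset.filter (fun I : Finset α => M.Indep ↑I)).sup Finset.card

/-- Greedy selection of representatives. -/
lemma greedy_reps {J : Type*} (R : J → ℝ) (rel : J → J → Prop)
    (hsymm : ∀ j k, rel j k → rel k j) (n : ℕ) :
    ∀ s : Finset J, s.card ≤ n → ∃ D' : Finset J, D' ⊆ s ∧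
      (∀ j ∈ D', ∀ k ∈ D', j ≠ k → ¬ rel j k) ∧
      (∀ j ∈ s, ∃ k ∈ D', (k = j ∨ rel j k) ∧ R k ≤ R j) := by
  induction n with
  | zero =>
    intro s hs
    have : s = ∅ := by simpa using hs
    subst this
    exact ⟨∅, by simp⟩
  | succ n ih =>
    intro s hs
    rcases s.eq_empty_or_nonempty with rfl | hne
    · exact ⟨∅, by simp⟩
    obtain ⟨j0, hj0, hmin⟩ := s.exists_min_image R hne
    obtain ⟨D', hsub, hpair, hcov⟩ := ih (s.filter (fun j => j ≠ j0 ∧ ¬ rel j j0)) (by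
      have : s.filter (fun j => j ≠ j0 ∧ ¬ rel j j0) ⊆ s.erase j0 := by
        intro j; simp only [mem_filter, mem_erase]; tauto
      have h1 := card_le_card this
      have h2 := card_erase_of_mem hj0
      omega)
    refine ⟨insert j0 D', ?_, ?_, ?_⟩
    · intro j hj
      rcases mem_insert.1 hj with rfl | hj
      · exact hj0
      · exact (mem_filter.1 (hsub hj)).1
    · intro j hj k hk hjk
      rcases mem_insert.1 hj with hj1 | hj1 <;> rcases mem_insert.1 hk with hk1 | hk1
      · exact absurd (hj1.trans hk1.symm) hjk
      · subst hj1; intro h; exact (mem_filter.1 (hsub hk1)).2.2 (hsymm _ _ h)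
      · subst hk1; exact (mem_filter.1 (hsub hj1)).2.2
      · exact hpair j hj1 k hk1 hjk
    · intro j hj
      by_cases h : j ≠ j0 ∧ ¬ rel j j0
      · obtain ⟨k, hk, h'⟩ := hcov j (mem_filter.2 ⟨hj, h⟩)
        exact ⟨k, mem_insert_of_mem hk, h'⟩
      · refine ⟨j0, mem_insert_self _ _, ?_, hmin j hj⟩
        by_cases h1 : j = j0
        · exact Or.inl h1.symm
        · right; by_contra h2; exact h ⟨h1, h2⟩

/-- Elements lying in the same members of a lattice of integral-sum sets have integral sum. -/
lemma lattice_class_int {E : Type*} [Fintype E] (z : E → ℝ) (P : Finset E → Prop)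
    (hemp : P ∅) (hun : ∀ S T, P S → P T → P (S ∪ T)) (hint : ∀ S T, P S → P T → P (S ∩ T))
    (hz : ∀ S, P S → ∃ n : ℤ, ∑ e ∈ S, z e = n) (e : E) (he : ∃ S, P S ∧ e ∈ S) :
    ∃ n : ℤ, ∑ e' ∈ univ.filter (fun e' => ∀ S, P S → (e' ∈ S ↔ e ∈ S)), z e' = n := by
  -- smallest member containing `e`
  have hD : ∃ D, P D ∧ e ∈ D ∧ ∀ S, P S → e ∈ S → D ⊆ S := by
    obtain ⟨S0, hS0⟩ := he
    obtain ⟨D, hD, hmin⟩ := (univ.filter (fun S => P S ∧ e ∈ S)).exists_min_image Finset.card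
      ⟨S0, by simpa using hS0⟩
    simp only [mem_filter, mem_univ, true_and] at hD hmin
    refine ⟨D, hD.1, hD.2, fun S hS heS => ?_⟩
    have h1 := hmin (D ∩ S) ⟨hint _ _ hD.1 hS, mem_inter.2 ⟨hD.2, heS⟩⟩
    have h2 := eq_of_subset_of_card_le inter_subset_left h1
    exact inter_eq_left.1 h2
  obtain ⟨D, hPD, heD, hDmin⟩ := hD
  have hU : ∃ U, P U ∧ U ⊆ D ∧ e ∉ U ∧ ∀ S, P S → S ⊆ D → e ∉ S → S ⊆ U := by
    obtain ⟨U, hU, hmax⟩ := (univ.filter (fun S => P S ∧ S ⊆ D ∧ e ∉ S)).exists_max_image Finset.card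
      ⟨∅, by simpa using hemp⟩
    simp only [mem_filter, mem_univ, true_and] at hU hmax
    refine ⟨U, hU.1, hU.2.1, hU.2.2, fun S hS hSD heS => ?_⟩
    have h1 := hmax (U ∪ S) ⟨hun _ _ hU.1 hS, union_subset hU.2.1 hSD, by
      simp [heS, hU.2.2]⟩
    have h2 := eq_of_subset_of_card_le subset_union_left h1
    rw [h2]; exact subset_union_right
  obtain ⟨U, hPU, hUD, heU, hUmax⟩ := hU
  have hcl : univ.filter (fun e' => ∀ S, P S → (e' ∈ S ↔ e ∈ S)) = D \ U := by
    ext e'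
    simp only [mem_filter, mem_univ, true_and, mem_sdiff]
    constructor
    · intro h
      exact ⟨(h D hPD).2 heD, fun h' => heU ((h U hPU).1 h')⟩
    · rintro ⟨h1, h2⟩ S hS
      constructor
      · intro h3
        by_contra h4
        exact h2 (hUmax (S ∩ D) (hint _ _ hS hPD) inter_subset_right
          (fun h => h4 (mem_inter.1 h).1) (mem_inter.2 ⟨h3, h1⟩))
      · intro h3; exact hDmin S hS h3 h1
  obtain ⟨n, hn⟩ := hz D hPD
  obtain ⟨m, hm⟩ := hz U hPU
  refine ⟨n - m, ?_⟩
  rw [hcl]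
  have := sum_sdiff (f := z) hUD
  push_cast
  linarith

/-- Unions of members of a laminar family with integral sums have integral sums. -/
lemma laminar_union_int {E : Type*} (z : E → ℝ) (Q : Finset E → Prop)
    (hQi : ∀ S T, Q S → Q T → Q (S ∩ T)) (hz : ∀ S, Q S → ∃ n : ℤ, ∑ e ∈ S, z e = n) (n : ℕ) :
    ∀ A : Finset (Finset E), A.card ≤ n → (∀ S ∈ A, Q S) →
      ∃ n : ℤ, ∑ e ∈ A.sup id, z e = n := by
  induction n with
  | zero =>
    intro A hA _
    have : A = ∅ := by simpa using hA
    subst this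
    exact ⟨0, by simp⟩
  | succ n ih =>
    intro A hA hQ
    rcases A.eq_empty_or_nonempty with rfl | ⟨S, hS⟩
    · exact ⟨0, by simp⟩
    have hc := card_erase_of_mem hS
    obtain ⟨a, ha⟩ := hz S (hQ S hS)
    obtain ⟨b, hb⟩ := ih (A.erase S) (by omega) (fun T hT => hQ T (mem_of_mem_erase hT))
    obtain ⟨k, hk⟩ := ih ((A.erase S).image (fun T => S ∩ T))
      (card_image_le.trans (by omega)) (by
        intro T hT
        obtain ⟨T', hT', rfl⟩ := mem_image.1 hT
        exact hQi _ _ (hQ S hS) (hQ T' (mem_of_mem_erase hT')))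
    have h1 : A.sup id = S ∪ (A.erase S).sup id := by
      conv_lhs => rw [← insert_erase hS]
      rw [sup_insert]; rfl
    have h2 : ((A.erase S).image (fun T => S ∩ T)).sup id = S ∩ (A.erase S).sup id := by
      ext e
      simp only [mem_sup, mem_image, mem_inter, id]
      constructor
      · rintro ⟨v, ⟨T, hT, rfl⟩, he⟩
        exact ⟨(mem_inter.1 he).1, T, hT, (mem_inter.1 he).2⟩
      · rintro ⟨h, T, hT, he⟩
        exact ⟨_, ⟨T, hT, rfl⟩, mem_inter.2 ⟨h, he⟩⟩
    refine ⟨a + b - k, ?_⟩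
    rw [h1]
    rw [h2] at hk
    have := sum_union_inter (f := z) (s₁ := S) (s₂ := (A.erase S).sup id)
    push_cast
    linarith

/-- Alternating direction. -/
lemma exists_direction {E α : Type*} [Fintype E] [DecidableEq α] (z : E → ℝ)
    (κ₁ : E → α) (κ₂ : E → α) (a0 : α) (b0 : α)
    (h1 : ∀ e, κ₁ e ≠ a0 → ∃ n : ℤ, ∑ e' ∈ univ.filter (fun e' => κ₁ e' = κ₁ e), z e' = n)
    (h2 : ∀ e, κ₂ e ≠ b0 → ∃ n : ℤ, ∑ e' ∈ univ.filter (fun e' => κ₂ e' = κ₂ e), z e' = n)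
    (hfrac : ∃ e, ¬ ∃ n : ℤ, z e = n) :
    ∃ v : E → ℝ, v ≠ 0 ∧ (∀ e, (∃ n : ℤ, z e = n) → v e = 0) ∧
      (∀ a, a ≠ a0 → ∑ e ∈ univ.filter (fun e => κ₁ e = a), v e = 0) ∧
      (∀ b, b ≠ b0 → ∑ e ∈ univ.filter (fun e => κ₂ e = b), v e = 0) := by
  set Fr : Finset E := univ.filter (fun e => ¬ ∃ n : ℤ, z e = n) with hFr
  have key : ∀ {γ : Type _} [DecidableEq γ] (κ : E → γ) (g0 : γ)
      (h : ∀ e, κ e ≠ g0 → ∃ n : ℤ, ∑ e' ∈ univ.filter (fun e' => κ e' = κ e), z e' = n),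
      ∀ g ∈ (Fr.image κ).erase g0, 2 ≤ (Fr.filter (fun e => κ e = g)).card := by
    intro γ _ κ g0 h g hg
    obtain ⟨hg0, hg⟩ := mem_erase.1 hg
    obtain ⟨e, he, rfl⟩ := mem_image.1 hg
    by_contra hlt
    have hem : e ∈ Fr.filter (fun e' => κ e' = κ e) := mem_filter.2 ⟨he, rfl⟩
    have hc : (Fr.filter (fun e' => κ e' = κ e)).card = 1 := by
      have := card_pos.2 ⟨e, hem⟩; omega
    obtain ⟨e1, he1⟩ := card_eq_one.1 hc
    have : e1 = e := by rw [he1] at hem; exact (mem_singleton.1 hem).symm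
    subst this
    obtain ⟨n, hn⟩ := h e1 hg0
    have hint : ∃ m : ℤ, ∑ e' ∈ (univ.filter (fun e' => κ e' = κ e1)).erase e1, z e' = m := by
      have : ∀ e' ∈ (univ.filter (fun e' => κ e' = κ e1)).erase e1, ∃ m : ℤ, z e' = m := by
        intro e' he'
        by_contra hcon
        have : e' ∈ Fr.filter (fun e' => κ e' = κ e1) := by
          simp only [mem_erase, mem_filter, mem_univ, true_and] at he'
          simp only [hFr, mem_filter, mem_univ, true_and]
          exact ⟨hcon, he'.2⟩
        rw [he1] at this
        exact (mem_erase.1 he').1 (mem_singleton.1 this)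
      choose! m hm using this
      exact ⟨∑ e' ∈ (univ.filter (fun e' => κ e' = κ e1)).erase e1, m e', by
        push_cast; exact sum_congr rfl hm⟩
    obtain ⟨m, hm⟩ := hint
    have := add_sum_erase (univ.filter (fun e' => κ e' = κ e1)) z (a := e1) (by simp)
    have h3 : e1 ∈ Fr := he
    simp only [hFr, mem_filter, mem_univ, true_and] at h3
    exact h3 ⟨n - m, by push_cast; linarith⟩
  have cnt : ∀ {γ : Type _} [DecidableEq γ] (κ : E → γ) (g0 : γ)
      (h : ∀ e, κ e ≠ g0 → ∃ n : ℤ, ∑ e' ∈ univ.filter (fun e' => κ e' = κ e), z e' = n),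
      2 * ((Fr.image κ).erase g0).card ≤ (Fr.filter (fun e => κ e ≠ g0)).card := by
    intro γ _ κ g0 h
    have hk := key κ g0 h
    have : (Fr.filter (fun e => κ e ≠ g0)).card =
        ∑ g ∈ (Fr.image κ).erase g0, ((Fr.filter (fun e => κ e ≠ g0)).filter (fun e => κ e = g)).card := by
      apply card_eq_sum_card_fiberwise
      intro e he
      simp only [coe_filter, Set.mem_ofPred_eq] at he
      simp only [coe_erase, coe_image]
      exact ⟨⟨e, he.1, rfl⟩, he.2⟩
    rw [this, mul_comm, ← smul_eq_mul]
    apply card_nsmul_le_sum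
    intro g hg
    refine (hk g hg).trans (card_le_card ?_)
    intro e he
    simp only [mem_filter] at he ⊢
    exact ⟨⟨he.1, he.2 ▸ (mem_erase.1 hg).1⟩, he.2⟩
  have c1 := cnt κ₁ a0 h1
  have c2 := cnt κ₂ b0 h2
  set N1 := (Fr.image κ₁).erase a0
  set N2 := (Fr.image κ₂).erase b0
  have f1 : (Fr.filter (fun e => κ₁ e ≠ a0)).card ≤ Fr.card := card_filter_le _ _
  have f2 : (Fr.filter (fun e => κ₂ e ≠ b0)).card ≤ Fr.card := card_filter_le _ _
  have hpos : 0 < Fr.card := by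
    obtain ⟨e, he⟩ := hfrac
    exact card_pos.2 ⟨e, by simp only [hFr, mem_filter, mem_univ, true_and]; exact he⟩
  let Φ : (Fr → ℝ) →ₗ[ℝ] ((N1 ⊕ N2) → ℝ) :=
    { toFun := fun v => Sum.elim (fun a => ∑ e : Fr, if κ₁ e = a then v e else 0)
        (fun b => ∑ e : Fr, if κ₂ e = b then v e else 0)
      map_add' := by
        intro v w
        ext (a | b) <;> simp only [Sum.elim_inl, Sum.elim_inr, Pi.add_apply, ← sum_add_distrib] <;>
          refine sum_congr rfl fun e _ => ?_ <;> split_ifs <;> simp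
      map_smul' := by
        intro r v
        ext (a | b) <;> simp only [Sum.elim_inl, Sum.elim_inr, Pi.smul_apply, smul_eq_mul, mul_sum, RingHom.id_apply] <;>
          refine sum_congr rfl fun e _ => ?_ <;> split_ifs <;> simp }
  have hdim : ¬ Function.Injective Φ := by
    intro hinj
    have hle := LinearMap.finrank_le_finrank_of_injective hinj
    simp only [Module.finrank_fintype_fun_eq_card, Fintype.card_coe, Fintype.card_sum] at hle
    have hsurj : Function.Surjective Φ := by
      have heq : Module.finrank ℝ (Fr → ℝ) = Module.finrank ℝ ((N1 ⊕ N2) → ℝ) := by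
        simp only [Module.finrank_fintype_fun_eq_card, Fintype.card_coe, Fintype.card_sum]
        omega
      exact (LinearMap.injective_iff_surjective_of_finrank_eq_finrank heq).1 hinj
    have g1 : ∀ e ∈ Fr, κ₁ e ≠ a0 := by
      rw [← filter_eq_self]
      exact eq_of_subset_of_card_le (filter_subset _ _) (by omega)
    have g2 : ∀ e ∈ Fr, κ₂ e ≠ b0 := by
      rw [← filter_eq_self]
      exact eq_of_subset_of_card_le (filter_subset _ _) (by omega)
    obtain ⟨v, hv⟩ := hsurj (Sum.elim (fun _ => 1) (fun _ => 0))
    have s1 : ∑ a : N1, Φ v (Sum.inl a) = ∑ e : Fr, v e := by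
      show ∑ a : N1, ∑ e : Fr, (if κ₁ e = a then v e else 0) = _
      rw [sum_comm]
      refine sum_congr rfl fun e _ => ?_
      rw [Fintype.sum_eq_single (⟨κ₁ e, mem_erase.2 ⟨g1 e e.2, mem_image_of_mem _ e.2⟩⟩ : N1)]
      · simp
      · intro a ha
        rw [if_neg]
        intro h; apply ha; ext; exact h.symm
    have s2 : ∑ b : N2, Φ v (Sum.inr b) = ∑ e : Fr, v e := by
      show ∑ a : N2, ∑ e : Fr, (if κ₂ e = a then v e else 0) = _
      rw [sum_comm]
      refine sum_congr rfl fun e _ => ?_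
      rw [Fintype.sum_eq_single (⟨κ₂ e, mem_erase.2 ⟨g2 e e.2, mem_image_of_mem _ e.2⟩⟩ : N2)]
      · simp
      · intro a ha
        rw [if_neg]
        intro h; apply ha; ext; exact h.symm
    rw [hv] at s1 s2
    simp at s1 s2
    rw [← s2] at s1
    have : N1.card = 0 := by exact_mod_cast s1
    omega
  have hker : ∃ v, Φ v = 0 ∧ v ≠ 0 := by
    by_contra hcon
    push Not at hcon
    exact hdim ((injective_iff_map_eq_zero Φ).2 hcon)
  obtain ⟨v, hv, hv0⟩ := hker
  have ext : ∀ {γ : Type _} [DecidableEq γ] (κ : E → γ) (g : γ),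
      ∑ e ∈ univ.filter (fun e => κ e = g), (if h : e ∈ Fr then v ⟨e, h⟩ else 0) =
        ∑ e : Fr, if κ e = g then v e else 0 := by
    intro γ _ κ g
    rw [sum_filter]
    have : ∑ e : Fr, (if κ e = g then v e else 0) =
        ∑ e ∈ Fr, if κ e = g then (if h : e ∈ Fr then v ⟨e, h⟩ else 0) else 0 := by
      rw [← sum_coe_sort Fr]
      refine sum_congr rfl fun e _ => ?_
      simp
    rw [this]
    symm
    apply sum_subset (subset_univ _)
    intro e _ he
    simp [he]
  refine ⟨fun e => if h : e ∈ Fr then v ⟨e, h⟩ else 0, ?_, ?_, ?_, ?_⟩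
  · intro h
    apply hv0
    ext e
    have := congrFun h e
    simpa using this
  · intro e he
    have : e ∉ Fr := by
      simp only [hFr, mem_filter, mem_univ, true_and, not_not]; exact he
    simp [this]
  · intro a ha
    rw [ext]
    by_cases hm : a ∈ N1
    · exact congrFun hv (Sum.inl ⟨a, hm⟩)
    · apply sum_eq_zero
      intro e _
      rw [if_neg]
      rintro rfl
      exact hm (mem_erase.2 ⟨ha, mem_image_of_mem _ e.2⟩)
  · intro a ha
    rw [ext]
    by_cases hm : a ∈ N2
    · exact congrFun hv (Sum.inr ⟨a, hm⟩)
    · apply sum_eq_zero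
      intro e _
      rw [if_neg]
      rintro rfl
      exact hm (mem_erase.2 ⟨ha, mem_image_of_mem _ e.2⟩)

/-- The labels used to cut the ground set into classes. -/
noncomputable def classLabel {E : Type*} [Fintype E] (P : Finset E → Prop) (e : E) :
    Finset (Finset E) := univ.filter (fun S => P S ∧ e ∈ S)

lemma classLabel_eq_iff {E : Type*} [Fintype E] (P : Finset E → Prop) (e e' : E) :
    classLabel P e' = classLabel P e ↔ ∀ S, P S → (e' ∈ S ↔ e ∈ S) := by
  simp only [classLabel, Finset.ext_iff, mem_filter, mem_univ, true_and]
  constructor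
  · intro h S hS; have := h S; tauto
  · intro h S; have := h S; tauto

lemma classLabel_int {E : Type*} [Fintype E] (z : E → ℝ) (P : Finset E → Prop)
    (hemp : P ∅) (hun : ∀ S T, P S → P T → P (S ∪ T)) (hint : ∀ S T, P S → P T → P (S ∩ T))
    (hz : ∀ S, P S → ∃ n : ℤ, ∑ e ∈ S, z e = n) (e : E) (he : classLabel P e ≠ ∅) :
    ∃ n : ℤ, ∑ e' ∈ univ.filter (fun e' => classLabel P e' = classLabel P e), z e' = n := by
  obtain ⟨S, hS⟩ := nonempty_iff_ne_empty.2 he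
  obtain ⟨n, hn⟩ := lattice_class_int z P hemp hun hint hz e ⟨S, (mem_filter.1 hS).2⟩
  refine ⟨n, hn ▸ ?_⟩
  apply sum_congr _ (fun _ _ => rfl)
  ext e'
  simp only [mem_filter, mem_univ, true_and]
  exact classLabel_eq_iff P e e'

lemma classLabel_sum_zero {E : Type*} [Fintype E] (P : Finset E → Prop) (v : E → ℝ)
    (hv : ∀ a, a ≠ ∅ → ∑ e ∈ univ.filter (fun e => classLabel P e = a), v e = 0)
    (S : Finset E) (hS : P S) : ∑ e ∈ S, v e = 0 := by
  rw [← sum_fiberwise_of_maps_to (t := univ) (g := classLabel P) (fun _ _ => mem_univ _)]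
  apply sum_eq_zero
  intro a _
  by_cases ha : S ∈ a
  · have : S.filter (fun e => classLabel P e = a) = univ.filter (fun e => classLabel P e = a) := by
      ext e
      simp only [mem_filter, mem_univ, true_and, and_iff_right_iff_imp]
      rintro rfl
      exact (mem_filter.1 ha).2.2
    rw [this]
    exact hv a (fun h => by simp [h] at ha)
  · have : S.filter (fun e => classLabel P e = a) = ∅ := by
      ext e
      simp only [mem_filter, notMem_empty, iff_false, not_and]
      rintro he rfl
      exact ha (mem_filter.2 ⟨mem_univ _, hS, he⟩)
    rw [this, sum_empty]

set_option maxHeartbeats 2000000 in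
/-- Integrality of the intersection of a submodular polyhedron with laminar constraints. -/
theorem submod_laminar_round {E ι : Type*} [Fintype E] [Fintype ι]
    (ρ : Finset E → ℤ) (hρ0 : ρ ∅ = 0)
    (hsub : ∀ S T, ρ (S ∪ T) + ρ (S ∩ T) ≤ ρ S + ρ T)
    (T : ι → Finset E) (hlam : ∀ k k', Disjoint (T k) (T k') ∨ T k ⊆ T k' ∨ T k' ⊆ T k)
    (lo hi : ι → ℤ) (w z0 : E → ℝ) (hz0 : ∀ e, 0 ≤ z0 e)
    (hzρ : ∀ S, ∑ e ∈ S, z0 e ≤ ρ S)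
    (hzlo : ∀ k, (lo k : ℝ) ≤ ∑ e ∈ T k, z0 e) (hzhi : ∀ k, ∑ e ∈ T k, z0 e ≤ hi k) :
    ∃ z : E → ℤ, (∀ e, 0 ≤ z e) ∧ (∀ S, ∑ e ∈ S, z e ≤ ρ S) ∧
      (∀ k, lo k ≤ ∑ e ∈ T k, z e) ∧ (∀ k, ∑ e ∈ T k, z e ≤ hi k) ∧
      ∑ e, w e * z e ≤ ∑ e, w e * z0 e := by
  set Pz : Set (E → ℝ) := {z | (∀ e, 0 ≤ z e) ∧ (∀ S, ∑ e ∈ S, z e ≤ ρ S) ∧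
      (∀ k, (lo k : ℝ) ≤ ∑ e ∈ T k, z e) ∧ (∀ k, ∑ e ∈ T k, z e ≤ hi k)} with hPz
  have hcl : IsClosed Pz := by
    have h1 : IsClosed {z : E → ℝ | ∀ e, 0 ≤ z e} := by
      simp only [Set.ofPred_forall]
      exact isClosed_iInter fun e => isClosed_le continuous_const (continuous_apply e)
    have h2 : IsClosed {z : E → ℝ | ∀ S, ∑ e ∈ S, z e ≤ ρ S} := by
      simp only [Set.ofPred_forall]
      exact isClosed_iInter fun S => isClosed_le (by fun_prop) continuous_const
    have h3 : IsClosed {z : E → ℝ | ∀ k, (lo k : ℝ) ≤ ∑ e ∈ T k, z e} := by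
      simp only [Set.ofPred_forall]
      exact isClosed_iInter fun S => isClosed_le continuous_const (by fun_prop)
    have h4 : IsClosed {z : E → ℝ | ∀ k, ∑ e ∈ T k, z e ≤ hi k} := by
      simp only [Set.ofPred_forall]
      exact isClosed_iInter fun S => isClosed_le (by fun_prop) continuous_const
    exact h1.inter (h2.inter (h3.inter h4))
  have hcomp : IsCompact Pz := by
    apply (isCompact_Icc (a := (0 : E → ℝ)) (b := fun e => (ρ {e} : ℝ))).of_isClosed_subset hcl
    intro z hz
    refine ⟨fun e => hz.1 e, fun e => ?_⟩
    simpa using hz.2.1 {e}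
  let l : StrongDual ℝ (E → ℝ) :=
    LinearMap.toContinuousLinearMap
      { toFun := fun z => - ∑ e, w e * z e
        map_add' := by intro a b; simp [mul_add, sum_add_distrib]; ring
        map_smul' := by intro r a; simp [mul_sum]; exact sum_congr rfl fun e _ => by ring }
  have hl : ∀ z, l z = - ∑ e, w e * z e := fun z => rfl
  have hexp : IsExposed ℝ Pz (l.toExposed Pz) := ContinuousLinearMap.toExposed.isExposed
  have hBne : (l.toExposed Pz).Nonempty := by
    obtain ⟨z, hz, hmax⟩ := hcomp.exists_isMaxOn ⟨z0, hz0, hzρ, hzlo, hzhi⟩ l.continuous.continuousOn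
    exact ⟨z, hz, fun y hy => hmax hy⟩
  obtain ⟨z, hzB⟩ := (hexp.isCompact hcomp).extremePoints_nonempty hBne
  have hzext := hexp.isExtreme.extremePoints_subset_extremePoints hzB
  have hzcost : ∑ e, w e * z e ≤ ∑ e, w e * z0 e := by
    have := hzB.1.2 z0 ⟨hz0, hzρ, hzlo, hzhi⟩
    rw [hl, hl] at this; linarith
  have hzP : z ∈ Pz := hzB.1.1
  have hzint : ∀ e, ∃ n : ℤ, z e = n := by
    by_contra hcon
    push Not at hcon
    have hfrac : ∃ e, ¬ ∃ n : ℤ, z e = n := by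
      obtain ⟨e, he⟩ := hcon; exact ⟨e, by push Not; exact he⟩
    obtain ⟨hp0, hpρ, hplo, hphi⟩ := hzP
    -- the two lattices of tight sets
    set P1 : Finset E → Prop := fun S => ∑ e ∈ S, z e = ρ S with hP1
    have tight : ∀ S S', P1 S → P1 S' → P1 (S ∪ S') ∧ P1 (S ∩ S') := by
      intro S S' h h'
      simp only [hP1] at h h' ⊢
      have a1 := sum_union_inter (f := z) (s₁ := S) (s₂ := S')
      have a2 := hpρ (S ∪ S')
      have a3 := hpρ (S ∩ S')
      have a4 : (ρ (S ∪ S') : ℝ) + ρ (S ∩ S') ≤ ρ S + ρ S' := by exact_mod_cast hsub S S'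
      constructor <;> linarith
    set Q : Finset E → Prop := fun B => B = ∅ ∨
      ∃ k, (∑ e ∈ T k, z e = lo k ∨ ∑ e ∈ T k, z e = hi k) ∧ B = T k with hQ
    have hQi : ∀ S S', Q S → Q S' → Q (S ∩ S') := by
      rintro S S' (rfl | ⟨k, hk, rfl⟩) (rfl | ⟨k', hk', rfl⟩)
      · left; simp
      · left; simp
      · left; simp
      · rcases hlam k k' with h | h | h
        · left; exact disjoint_iff_inter_eq_empty.1 h
        · right; exact ⟨k, hk, inter_eq_left.2 h⟩
        · right; exact ⟨k', hk', inter_eq_right.2 h⟩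
    have hQz : ∀ S, Q S → ∃ n : ℤ, ∑ e ∈ S, z e = n := by
      rintro S (rfl | ⟨k, hk | hk, rfl⟩)
      · exact ⟨0, by simp⟩
      · exact ⟨_, hk⟩
      · exact ⟨_, hk⟩
    set P2 : Finset E → Prop := fun S => ∃ A : Finset (Finset E), (∀ B ∈ A, Q B) ∧ S = A.sup id with hP2
    have h1 := classLabel_int z P1 (by simp [hP1, hρ0]) (fun S S' h h' => (tight S S' h h').1)
      (fun S S' h h' => (tight S S' h h').2) (fun S h => ⟨_, h⟩)
    have h2 := classLabel_int z P2 ⟨∅, by simp, by simp⟩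
      (by
        rintro S S' ⟨A, hA, rfl⟩ ⟨A', hA', rfl⟩
        refine ⟨A ∪ A', ?_, ?_⟩
        · intro B hB
          rcases mem_union.1 hB with h | h
          · exact hA B h
          · exact hA' B h
        · rw [sup_union]; rfl)
      (by
        rintro S S' ⟨A, hA, rfl⟩ ⟨A', hA', rfl⟩
        refine ⟨(A ×ˢ A').image (fun p => p.1 ∩ p.2), ?_, ?_⟩
        · intro B hB
          obtain ⟨p, hp, rfl⟩ := mem_image.1 hB
          exact hQi _ _ (hA _ (mem_product.1 hp).1) (hA' _ (mem_product.1 hp).2)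
        · ext e
          simp only [mem_inter, mem_sup, mem_image, mem_product, id]
          constructor
          · rintro ⟨⟨B, hB, heB⟩, ⟨B', hB', heB'⟩⟩
            exact ⟨_, ⟨(B, B'), ⟨hB, hB'⟩, rfl⟩, mem_inter.2 ⟨heB, heB'⟩⟩
          · rintro ⟨_, ⟨p, hp, rfl⟩, he⟩
            exact ⟨⟨p.1, hp.1, (mem_inter.1 he).1⟩, ⟨p.2, hp.2, (mem_inter.1 he).2⟩⟩)
      (by
        rintro S ⟨A, hA, rfl⟩
        exact laminar_union_int z Q hQi hQz A.card A le_rfl hA)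
    obtain ⟨v, hv0, hvint, hv1, hv2⟩ := exists_direction z (classLabel P1) (classLabel P2) ∅ ∅
      h1 h2 hfrac
    have hvS := classLabel_sum_zero P1 v hv1
    have hvT : ∀ k, (∑ e ∈ T k, z e = lo k ∨ ∑ e ∈ T k, z e = hi k) → ∑ e ∈ T k, v e = 0 := by
      intro k hk
      refine classLabel_sum_zero P2 v hv2 (T k) ?_
      exact ⟨{T k}, by simpa using Or.inr ⟨k, hk, rfl⟩, by simp⟩
    -- small moves stay inside
    have hsmall : ∀ᶠ ε : ℝ in nhds 0, (fun e => z e + ε * v e) ∈ Pz := by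
      have lin : ∀ (S : Finset E) (ε : ℝ), ∑ e ∈ S, (z e + ε * v e) = ∑ e ∈ S, z e + ε * ∑ e ∈ S, v e := by
        intro S ε; rw [sum_add_distrib, mul_sum]
      have up : ∀ a b c : ℝ, a ≤ c → (a = c → b = 0) → ∀ᶠ ε : ℝ in nhds 0, a + ε * b ≤ c := by
        intro a b c hac hb
        rcases hac.eq_or_lt with h | h
        · simp [hb h, hac]
        · have : Filter.Tendsto (fun ε : ℝ => a + ε * b) (nhds 0) (nhds (a + 0 * b)) :=
            Continuous.tendsto (by fun_prop) 0
          have := this.eventually_lt_const (u := c) (by simpa using h)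
          exact this.mono fun _ h => h.le
      have e1 : ∀ᶠ ε : ℝ in nhds 0, ∀ e, 0 ≤ z e + ε * v e := by
        rw [Filter.eventually_all]
        intro e
        have := up (-z e) (-v e) 0 (by linarith [hp0 e]) (by
          intro h; rw [hvint e ⟨0, by push_cast; linarith⟩]; simp)
        exact this.mono fun ε h => by linarith
      have e2 : ∀ᶠ ε : ℝ in nhds 0, ∀ S : Finset E, ∑ e ∈ S, (z e + ε * v e) ≤ ρ S := by
        rw [Filter.eventually_all]
        intro S
        simp only [lin]
        exact up _ _ _ (hpρ S) (hvS S)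
      have e3 : ∀ᶠ ε : ℝ in nhds 0, ∀ k, (lo k : ℝ) ≤ ∑ e ∈ T k, (z e + ε * v e) := by
        rw [Filter.eventually_all]
        intro k
        simp only [lin]
        have := up (-∑ e ∈ T k, z e) (-∑ e ∈ T k, v e) (-(lo k : ℝ)) (by linarith [hplo k]) (by
          intro h; rw [hvT k (Or.inl (by linarith))]; simp)
        exact this.mono fun ε h => by linarith
      have e4 : ∀ᶠ ε : ℝ in nhds 0, ∀ k, ∑ e ∈ T k, (z e + ε * v e) ≤ hi k := by
        rw [Filter.eventually_all]
        intro k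
        simp only [lin]
        exact up _ _ _ (hphi k) (fun h => hvT k (Or.inr h))
      filter_upwards [e1, e2, e3, e4] with ε a b c d
      exact ⟨a, b, c, d⟩
    obtain ⟨δ, hδ, hball⟩ := Metric.eventually_nhds_iff.1 hsmall
    have m1 := hball (y := δ / 2) (by rw [Real.dist_eq, sub_zero, abs_of_pos (by linarith)]; linarith)
    have m2 := hball (y := -(δ / 2)) (by rw [Real.dist_eq, sub_zero, abs_neg, abs_of_pos (by linarith)]; linarith)
    have := (mem_extremePoints.1 hzext).2 _ m1 _ m2 ⟨1/2, 1/2, by norm_num, by norm_num, by norm_num, by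
      ext e; simp; ring⟩
    apply hv0
    ext e
    have h := congrFun this.1 e
    have h3 : δ / 2 * v e = 0 := by linarith
    rcases mul_eq_zero.1 h3 with h | h
    · linarith
    · exact h
  choose n hn using hzint
  obtain ⟨hp0, hpρ, hplo, hphi⟩ := hzP
  simp only [hn] at hp0 hpρ hplo hphi hzcost
  exact ⟨n, fun e => by exact_mod_cast hp0 e, fun S => by exact_mod_cast hpρ S,
    fun k => by exact_mod_cast hplo k, fun k => by exact_mod_cast hphi k, hzcost⟩

lemma matroidRank_eq_eRk {α : Type*} (M : Matroid α) (S : Finset α) :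
    (matroidRank M S : ℕ∞) = M.eRk (S : Set α) := by
  apply le_antisymm
  · rw [Matroid.le_eRk_iff]
    obtain ⟨I, hI, hc⟩ := exists_mem_eq_sup (S.powerset.filter (fun I : Finset α => M.Indep ↑I))
      ⟨∅, by simp⟩ Finset.card
    simp only [mem_filter, mem_powerset] at hI
    refine ⟨I, by exact_mod_cast hI.1, hI.2, ?_⟩
    rw [Set.encard_coe_eq_coe_finsetCard, matroidRank, hc]
  · rw [Matroid.eRk_le_iff]
    intro I hIS hI
    have hfin : I.Finite := S.finite_toSet.subset hIS
    lift I to Finset α using hfin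
    rw [Set.encard_coe_eq_coe_finsetCard]
    have : I.card ≤ matroidRank M S :=
      le_sup (f := Finset.card) (by simpa using ⟨by exact_mod_cast hIS, hI⟩)
    exact_mod_cast this

lemma matroidRank_mono {α : Type*} (M : Matroid α) {S T : Finset α} (h : S ⊆ T) :
    matroidRank M S ≤ matroidRank M T := by
  have := M.eRk_mono (show (S : Set α) ⊆ T by exact_mod_cast h)
  rw [← matroidRank_eq_eRk, ← matroidRank_eq_eRk] at this
  exact_mod_cast this

lemma matroidRank_le_card {α : Type*} (M : Matroid α) (S : Finset α) :
    matroidRank M S ≤ S.card := by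
  have := M.eRk_le_encard (S : Set α)
  rw [← matroidRank_eq_eRk, Set.encard_coe_eq_coe_finsetCard] at this
  exact_mod_cast this

lemma matroidRank_submod {α : Type*} [DecidableEq α] (M : Matroid α) (S T : Finset α) :
    matroidRank M (S ∪ T) + matroidRank M (S ∩ T) ≤ matroidRank M S + matroidRank M T := by
  have := M.eRk_submod (S : Set α) T
  rw [← coe_union, ← coe_inter] at this
  simp only [← matroidRank_eq_eRk] at this
  have h : matroidRank M (S ∩ T) + matroidRank M (S ∪ T) ≤ matroidRank M S + matroidRank M T := by
    exact_mod_cast this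
  omega

lemma indep_of_card_le_matroidRank {α : Type*} (M : Matroid α) (S : Finset α)
    (h : S.card ≤ matroidRank M S) : M.Indep (S : Set α) := by
  rw [Matroid.indep_iff_eRk_eq_encard_of_finite S.finite_toSet, ← matroidRank_eq_eRk,
    Set.encard_coe_eq_coe_finsetCard]
  exact_mod_cast le_antisymm (matroidRank_le_card M S) h

/-- Combinatorial core: clustering of a half-integral solution. -/
lemma half_integral_clusters {A J : Type*} [Fintype A] [Fintype J]
    (cF : A → J → ℝ) (cJ : J → J → ℝ) (hF0 : ∀ i j, 0 ≤ cF i j)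
    (hsym : ∀ j k, cJ j k = cJ k j)
    (htri : ∀ i j k, cF i j ≤ cF i k + cJ k j)
    (htri2 : ∀ i j k, cJ j k ≤ cF i j + cF i k)
    (γ : J → ℝ) (hγ0 : ∀ j, 0 ≤ γ j) (hγ : ∀ j k, j ≠ k → 2 * γ j ≤ cJ j k)
    (G : J → Finset A) (hG : ∀ j, ∀ i ∈ G j, cF i j < γ j)
    (σ : J → J) (zz : A → ℤ) (hzz : ∀ i, 0 ≤ zz i)
    (hz : ∀ j, ∑ i ∈ G j, zz i = 2 ∨ (∑ i ∈ G j, zz i = 1 ∧ σ j ≠ j ∧ cJ j (σ j) = 2 * γ j)) :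
    ∃ (D2 : Finset J) (S : J → Finset A) (a : J → A) (p q : J → ℝ),
      (∀ j ∈ D2, ∀ k ∈ D2, j ≠ k → Disjoint (S j) (S k)) ∧
      (∀ j ∈ D2, 2 ≤ ∑ i ∈ S j, zz i) ∧
      (∀ h : A → ℤ, (∀ i, 0 ≤ h i) → (∀ j ∈ D2, 1 ≤ ∑ i ∈ S j, h i) → ∀ j,
        (0 < h (a j) → ∃ i, 0 < h i ∧ cF i j ≤ p j) ∧
        (h (a j) = 0 → ∃ i, 0 < h i ∧ cF i j ≤ q j)) ∧
      (∀ j, zz (a j) = 1 ∨ p j = q j) ∧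
      (∀ j, (p j + q j) / 2 ≤ ∑ i ∈ G j, cF i j * zz i + 2 * γ j * (2 - ∑ i ∈ G j, (zz i : ℝ))) := by
  -- the sets `G` are disjoint
  have hGd : ∀ j k i, i ∈ G j → i ∈ G k → j = k := by
    intro j k i hj hk
    by_contra hne
    have h1 := hG j i hj
    have h2 := hG k i hk
    have h3 := hγ j k hne
    have h4 := hγ k j (Ne.symm hne)
    have h5 := htri2 i j k
    have := hsym j k
    linarith
  -- primary facility
  have hprim : ∀ j, ∃ i ∈ G j, 1 ≤ zz i := by
    intro j
    by_contra hcon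
    push Not at hcon
    have : ∑ i ∈ G j, zz i ≤ 0 := sum_nonpos fun i hi => by have := hcon i hi; omega
    rcases hz j with h | h <;> omega
  choose i1 hi1 hzi1 using hprim
  have hle : ∀ j i, i ∈ G j → zz i ≤ ∑ i ∈ G j, zz i := fun j i hi =>
    single_le_sum (f := zz) (fun i _ => hzz i) hi
  have hcz : ∀ j, ∀ i ∈ G j, 0 ≤ cF i j * (zz i : ℝ) := fun j i _ =>
    mul_nonneg (hF0 i j) (by exact_mod_cast hzz i)
  -- secondary facility
  have hsec : ∀ j, ∃ i, (∑ i ∈ G j, zz i = 2 → i ∈ G j ∧ (zz (i1 j) = 1 ∨ i1 j = i) ∧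
        2 ≤ ∑ i' ∈ ({i1 j, i} : Finset A), zz i' ∧
        cF (i1 j) j + cF i j ≤ ∑ i ∈ G j, cF i j * zz i) ∧
      (∑ i ∈ G j, zz i = 1 → i = i1 (σ j)) := by
    intro j
    rcases hz j with h | ⟨h, -⟩
    · by_cases h2 : zz (i1 j) = 1
      · have : ∃ i ∈ (G j).erase (i1 j), 1 ≤ zz i := by
          by_contra hcon
          push Not at hcon
          have h3 : ∑ i ∈ (G j).erase (i1 j), zz i ≤ 0 :=
            sum_nonpos fun i hi => by have := hcon i hi; omega
          have := add_sum_erase (G j) zz (hi1 j)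
          omega
        obtain ⟨i, hi, hzi⟩ := this
        have hne : i ≠ i1 j := (mem_erase.1 hi).1
        have hiG := (mem_erase.1 hi).2
        refine ⟨i, fun _ => ⟨hiG, Or.inl h2, ?_, ?_⟩, fun h' => by omega⟩
        · rw [sum_pair (Ne.symm hne)]; omega
        · have hsubs : ({i1 j, i} : Finset A) ⊆ G j := by
            intro t ht
            simp only [mem_insert, mem_singleton] at ht
            rcases ht with rfl | rfl
            · exact hi1 j
            · exact hiG
          have h5 := sum_le_sum_of_subset_of_nonneg (f := fun i => cF i j * (zz i : ℝ)) hsubs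
            (fun i hi _ => hcz j i hi)
          rw [sum_pair (Ne.symm hne)] at h5
          have h6 : (1 : ℝ) ≤ zz i := by exact_mod_cast hzi
          have h7 : (1 : ℝ) ≤ zz (i1 j) := by exact_mod_cast hzi1 j
          have := hF0 i j
          have := hF0 (i1 j) j
          nlinarith
      · refine ⟨i1 j, fun _ => ⟨hi1 j, Or.inr rfl, ?_, ?_⟩, fun h' => by omega⟩
        · have := hzi1 j
          simp; omega
        · have h5 := single_le_sum (f := fun i => cF i j * (zz i : ℝ)) (hcz j) (hi1 j)
          have h6 : (2 : ℝ) ≤ zz (i1 j) := by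
            have := hzi1 j
            have : 2 ≤ zz (i1 j) := by omega
            exact_mod_cast this
          have := hF0 (i1 j) j
          nlinarith
    · exact ⟨i1 (σ j), fun h' => by omega, fun _ => rfl⟩
  choose i2 hi2f hi2h using hsec
  set R : J → ℝ := fun j => if ∑ i ∈ G j, zz i = 2 then cF (i1 j) j + cF (i2 j) j
    else cF (i1 j) j + cJ j (σ j) + cF (i1 (σ j)) (σ j) with hR
  have hRf : ∀ j, ∑ i ∈ G j, zz i = 2 → R j = cF (i1 j) j + cF (i2 j) j := by
    intro j h; simp only [hR, if_pos h]
  have hRh : ∀ j, ∑ i ∈ G j, zz i = 1 → R j = cF (i1 j) j + cJ j (σ j) + cF (i1 (σ j)) (σ j) := by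
    intro j h; simp only [hR]; rw [if_neg (by omega)]
  set S : J → Finset A := fun j => {i1 j, i2 j} with hS
  have hSm : ∀ i j, i ∈ S j ↔ i = i1 j ∨ i = i2 j := by intro i j; simp [hS]
  obtain ⟨D2, -, hpair, hcov⟩ := greedy_reps R (fun j k => ¬ Disjoint (S j) (S k))
    (fun j k h h' => h h'.symm) _ (univ : Finset J) le_rfl
  -- opening guarantee
  have hopen : ∀ h : A → ℤ, (∀ i, 0 ≤ h i) → (∀ j ∈ D2, 1 ≤ ∑ i ∈ S j, h i) → ∀ k ∈ D2,
      0 < h (i1 k) ∨ 0 < h (i2 k) := by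
    intro h h0 h1 k hk
    by_contra hcon
    push Not at hcon
    have : ∑ i ∈ S k, h i ≤ 0 := sum_nonpos fun i hi => by
      rcases (hSm i k).1 hi with rfl | rfl
      · exact hcon.1
      · exact hcon.2
    have := h1 k hk
    omega
  have hprim1 : ∀ j, zz (i1 j) = 1 ∨ i1 j = i2 j := by
    intro j
    rcases hz j with h | ⟨h, -⟩
    · exact (hi2f j h).2.1
    · left; have := hle j _ (hi1 j); have := hzi1 j; omega
  -- target values
  have htf : ∀ j, ∑ i ∈ G j, zz i = 2 →
      R j ≤ ∑ i ∈ G j, cF i j * zz i + 2 * γ j * (2 - ∑ i ∈ G j, (zz i : ℝ)) := by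
    intro j h
    have h' : ∑ i ∈ G j, (zz i : ℝ) = 2 := by exact_mod_cast h
    rw [h', hRf j h]
    have := (hi2f j h).2.2.2
    linarith
  have hth : ∀ j, ∑ i ∈ G j, zz i = 1 →
      cF (i1 j) j + 2 * γ j ≤ ∑ i ∈ G j, cF i j * zz i + 2 * γ j * (2 - ∑ i ∈ G j, (zz i : ℝ)) := by
    intro j h
    have h' : ∑ i ∈ G j, (zz i : ℝ) = 1 := by exact_mod_cast h
    rw [h']
    have h5 := single_le_sum (f := fun i => cF i j * (zz i : ℝ)) (hcz j) (hi1 j)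
    have h7 : (1 : ℝ) ≤ zz (i1 j) := by exact_mod_cast hzi1 j
    have := hF0 (i1 j) j
    nlinarith
  -- distance to a primary facility of another cluster
  have hfar : ∀ j k i, j ≠ k → i ∈ G k → cF i k ≤ cJ j k / 2 := by
    intro j k i hjk hi
    have := hG k i hi
    have := hγ k j (Ne.symm hjk)
    have := hsym j k
    linarith
  -- a cluster meeting `G j` from outside is half with `σ k = j`
  have hmeet : ∀ j k i, k ≠ j → i ∈ S k → i ∈ G j →
      ∑ i ∈ G k, zz i = 1 ∧ σ k = j ∧ i2 k = i1 j := by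
    intro j k i hkj hiS hiG
    have hk1 : i ≠ i1 k := by
      rintro rfl; exact hkj (hGd _ _ _ (hi1 k) hiG)
    have hk2 : i = i2 k := ((hSm i k).1 hiS).resolve_left hk1
    rcases hz k with h | ⟨h, -⟩
    · exact absurd (hGd _ _ _ (hi2f k h).1 (hk2 ▸ hiG)) hkj
    · have e := hi2h k h
      have : σ k = j := hGd _ _ i (by rw [hk2, e]; exact hi1 _) hiG
      exact ⟨h, this, by rw [e, this]⟩
  have hmain : ∀ j, ∃ (a : A) (p q : ℝ),
      (∀ h : A → ℤ, (∀ i, 0 ≤ h i) → (∀ j ∈ D2, 1 ≤ ∑ i ∈ S j, h i) →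
        (0 < h a → ∃ i, 0 < h i ∧ cF i j ≤ p) ∧
        (h a = 0 → ∃ i, 0 < h i ∧ cF i j ≤ q)) ∧
      (zz a = 1 ∨ p = q) ∧
      (p + q) / 2 ≤ ∑ i ∈ G j, cF i j * zz i + 2 * γ j * (2 - ∑ i ∈ G j, (zz i : ℝ)) := by
    intro j
    obtain ⟨k, hk, hkj, hRk⟩ := hcov j (mem_univ _)
    -- paying through the cluster `S k`
    have hvia : (∀ h : A → ℤ, (∀ i, 0 ≤ h i) → (∀ j ∈ D2, 1 ≤ ∑ i ∈ S j, h i) →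
        (0 < h (i1 k) → ∃ i, 0 < h i ∧ cF i j ≤ cF (i1 k) j) ∧
        (h (i1 k) = 0 → ∃ i, 0 < h i ∧ cF i j ≤ cF (i2 k) j)) ∧
        (zz (i1 k) = 1 ∨ cF (i1 k) j = cF (i2 k) j) := by
      refine ⟨fun h h0 h1 => ⟨fun hp => ⟨_, hp, le_rfl⟩, fun hp => ?_⟩, ?_⟩
      · have := (hopen h h0 h1 k hk).resolve_left (by omega)
        exact ⟨_, this, le_rfl⟩
      · rcases hprim1 k with h | h
        · exact Or.inl h
        · right; rw [← h]
    -- if the two cluster facilities are cheap on average, we are done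
    have hdone : (cF (i1 k) j + cF (i2 k) j) / 2 ≤
        ∑ i ∈ G j, cF i j * zz i + 2 * γ j * (2 - ∑ i ∈ G j, (zz i : ℝ)) →
        ∃ (a : A) (p q : ℝ),
      (∀ h : A → ℤ, (∀ i, 0 ≤ h i) → (∀ j ∈ D2, 1 ≤ ∑ i ∈ S j, h i) →
        (0 < h a → ∃ i, 0 < h i ∧ cF i j ≤ p) ∧
        (h a = 0 → ∃ i, 0 < h i ∧ cF i j ≤ q)) ∧
      (zz a = 1 ∨ p = q) ∧
      (p + q) / 2 ≤ ∑ i ∈ G j, cF i j * zz i + 2 * γ j * (2 - ∑ i ∈ G j, (zz i : ℝ)) :=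
      fun h => ⟨i1 k, _, _, hvia.1, hvia.2, h⟩
    have n1 := hF0 (i1 j) j
    have n2 := hγ0 j
    by_cases hkj' : k = j
    · subst hkj'
      apply hdone
      rcases hz k with h | ⟨h, hs, hs'⟩
      · have := htf k h
        rw [hRf k h] at this
        have := hF0 (i2 k) k
        linarith
      · have := hth k h
        rw [hi2h k h]
        have h1 := htri (i1 (σ k)) k (σ k)
        have h2 := hfar k (σ k) _ (Ne.symm hs) (hi1 (σ k))
        have := hsym k (σ k)
        linarith
    have hnd := hkj.resolve_left hkj'
    obtain ⟨i, hij, hik⟩ := not_disjoint_iff.1 hnd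
    -- the case where `S k` meets `G j`
    have hcase : ∀ i ∈ S k, i ∈ G j → cF (i1 k) j + cF (i2 k) j ≤ R j := by
      intro i hik hiG
      obtain ⟨e1, e2, e3⟩ := hmeet j k i hkj' hik hiG
      have h1 := hRh k e1
      rw [e2] at h1
      rw [e3]
      have := htri (i1 k) j k
      linarith
    rcases hz j with h | ⟨h, hs, hs'⟩
    · apply hdone
      have hiG : i ∈ G j := by
        rcases (hSm i j).1 hij with rfl | rfl
        · exact hi1 j
        · exact (hi2f j h).1
      have := hcase i hik hiG
      have := htf j h
      have := hF0 (i1 k) j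
      have := hF0 (i2 k) j
      linarith
    · have hRj := hRh j h
      have hT := hth j h
      have hl2 := hfar j (σ j) _ (Ne.symm hs) (hi1 (σ j))
      by_cases hi1S : i1 j ∈ S k
      · apply hdone
        have := hcase _ hi1S (hi1 j)
        linarith
      · have hi' : i = i1 (σ j) := by
          rcases (hSm i j).1 hij with rfl | rfl
          · exact absurd hik hi1S
          · exact hi2h j h
        subst hi'
        have hz1 : zz (i1 j) = 1 := by
          have := hle j _ (hi1 j); have := hzi1 j; omega
        have hB : cF (i1 k) j ≤ cF (i1 j) j + 4 * γ j ∧ cF (i2 k) j ≤ cF (i1 j) j + 4 * γ j := by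
          have hsy := hsym j (σ j)
          by_cases hkl : k = σ j
          · rw [← hkl] at hs' hRj hl2 hsy
            have ha := htri (i1 k) j k
            have hb := htri (i2 k) j k
            refine ⟨by linarith, ?_⟩
            rcases hz k with hf | ⟨hf, hs2, _⟩
            · have := hfar j k _ (Ne.symm hkj') (hi2f k hf).1
              linarith
            · have h1 := hRh k hf
              have h2 := hi2h k hf
              have h3 := htri (i2 k) k (σ k)
              rw [h2] at h3 hb
              rw [h2]
              have := hsym k (σ k)
              linarith
          · obtain ⟨e1, e2, e3⟩ := hmeet (σ j) k _ hkl hik (hi1 _)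
            have h1 := hRh k e1
            rw [e2] at h1
            rw [e3]
            have ha := htri (i1 (σ j)) j (σ j)
            have hb := htri (i1 k) j (σ j)
            have hc := htri (i1 k) (σ j) k
            exact ⟨by linarith, by linarith⟩
        refine ⟨i1 j, cF (i1 j) j, cF (i1 j) j + 4 * γ j, ?_, Or.inl hz1, by linarith⟩
        intro g g0 g1
        refine ⟨fun hp => ⟨_, hp, le_rfl⟩, fun _ => ?_⟩
        rcases hopen g g0 g1 k hk with ho | ho
        · exact ⟨_, ho, hB.1⟩
        · exact ⟨_, ho, hB.2⟩
  choose a p q h1 h2 h3 using hmain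
  refine ⟨D2, S, a, p, q, ?_, ?_, fun h h0 hD j => h1 j h h0 hD, h2, h3⟩
  · intro j hj k hk hjk
    exact not_not.1 (hpair j hj k hk hjk)
  · intro j hj
    rcases hz j with h | ⟨h, hs, _⟩
    · exact (hi2f j h).2.2.1
    · have e := hi2h j h
      have hne : i1 j ≠ i2 j := by
        rw [e]; intro he
        exact hs (hGd _ _ _ (hi1 (σ j)) (he ▸ hi1 j))
      show 2 ≤ ∑ i ∈ {i1 j, i2 j}, zz i
      rw [sum_pair hne, e]
      have := hzi1 j
      have := hzi1 (σ j)
      omega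

/-- Projection from the ground set with duplicated facilities. -/
def dupProj {F1 F2 : Type*} : F1 ⊕ (F1 ⊕ F2) → F1 ⊕ F2 := Sum.elim Sum.inl id

lemma dup_round {F1 F2 X : Type*} [Fintype F1] [Fintype F2] [Fintype X]
    (M : Matroid (F1 ⊕ F2)) (L : Set (Finset F2))
    (hlaminar : ∀ S ∈ L, ∀ T ∈ L, Disjoint S T ∨ S ⊆ T ∨ T ⊆ S) (m : ℕ)
    (ℓ u : Finset F2 → ℤ) (lb1 ub1 lb ub : ℤ)
    (H : X → Finset F1) (hH : ∀ a b, a ≠ b → Disjoint (H a) (H b)) (lo hi : X → ℤ)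
    (W Y : F1 ⊕ (F1 ⊕ F2) → ℝ) (hY0 : ∀ e, 0 ≤ Y e)
    (hYr : ∀ S : Finset (F1 ⊕ (F1 ⊕ F2)), ∑ e ∈ S, Y e ≤ m * (matroidRank M (S.image dupProj) : ℝ))
    (hYL : ∀ S ∈ L, (ℓ S : ℝ) ≤ ∑ i ∈ S, Y (Sum.inr (Sum.inr i)) ∧
      ∑ i ∈ S, Y (Sum.inr (Sum.inr i)) ≤ u S)
    (hY1 : (lb1 : ℝ) ≤ ∑ i : F1, Y (Sum.inl i) + ∑ i : F1, Y (Sum.inr (Sum.inl i)))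
    (hY1' : ∑ i : F1, Y (Sum.inl i) + ∑ i : F1, Y (Sum.inr (Sum.inl i)) ≤ ub1)
    (hY : (lb : ℝ) ≤ ∑ e, Y e) (hY' : ∑ e, Y e ≤ ub)
    (hX : ∀ a, (lo a : ℝ) ≤ ∑ i ∈ H a, Y (Sum.inl i))
    (hX' : ∀ a, ∑ i ∈ H a, Y (Sum.inl i) ≤ hi a) :
    ∃ Z : F1 ⊕ (F1 ⊕ F2) → ℤ, (∀ e, 0 ≤ Z e) ∧
      (∀ S : Finset (F1 ⊕ (F1 ⊕ F2)), ∑ e ∈ S, Z e ≤ m * (matroidRank M (S.image dupProj) : ℤ)) ∧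
      (∀ S ∈ L, ℓ S ≤ ∑ i ∈ S, Z (Sum.inr (Sum.inr i)) ∧
        ∑ i ∈ S, Z (Sum.inr (Sum.inr i)) ≤ u S) ∧
      lb1 ≤ ∑ i : F1, Z (Sum.inl i) + ∑ i : F1, Z (Sum.inr (Sum.inl i)) ∧
      ∑ i : F1, Z (Sum.inl i) + ∑ i : F1, Z (Sum.inr (Sum.inl i)) ≤ ub1 ∧
      lb ≤ ∑ e, Z e ∧ ∑ e, Z e ≤ ub ∧
      (∀ a, lo a ≤ ∑ i ∈ H a, Z (Sum.inl i)) ∧ (∀ a, ∑ i ∈ H a, Z (Sum.inl i) ≤ hi a) ∧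
      ∑ e, W e * Z e ≤ ∑ e, W e * Y e := by
  have : Fintype L := Fintype.ofFinite _
  let T : X ⊕ (L ⊕ Bool) → Finset (F1 ⊕ (F1 ⊕ F2)) := Sum.elim (fun a => (H a).disjSum ∅)
    (Sum.elim (fun S => (∅ : Finset F1).disjSum ((∅ : Finset F1).disjSum S.1))
      (fun b => if b then univ else
        (univ : Finset F1).disjSum ((univ : Finset F1).disjSum (∅ : Finset F2))))
  have hlam : ∀ k k', Disjoint (T k) (T k') ∨ T k ⊆ T k' ∨ T k' ⊆ T k := by
    have hXX : ∀ a b : X, a = b ∨ Disjoint (H a) (H b) := fun a b => by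
      by_cases h : a = b
      · exact Or.inl h
      · exact Or.inr (hH a b h)
    have hLX : ∀ S S' : L, Disjoint S.1 S'.1 ∨ S.1 ⊆ S'.1 ∨ S'.1 ⊆ S.1 :=
      fun S S' => hlaminar _ S.2 _ S'.2
    rintro (a | S | _ | _) (b | S' | _ | _)
    · rcases hXX a b with rfl | h
      · right; left; exact subset_rfl
      · left
        simpa [T, Finset.disjoint_left] using Finset.disjoint_left.1 h
    · left; simp [T, Finset.disjoint_left]
    · right; left; simp [T, Finset.subset_iff]
    · right; left; simp [T]
    · left; simp [T, Finset.disjoint_left]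
    · rcases hLX S S' with h | h | h
      · left; simpa [T, Finset.disjoint_left] using Finset.disjoint_left.1 h
      · right; left; simpa [T, Finset.subset_iff] using Finset.subset_iff.1 h
      · right; right; simpa [T, Finset.subset_iff] using Finset.subset_iff.1 h
    · left; simp [T, Finset.disjoint_left]
    · right; left; simp [T]
    · right; right; simp [T, Finset.subset_iff]
    · left; simp [T, Finset.disjoint_left]
    · right; left; exact subset_rfl
    · right; left; simp [T]
    · right; right; simp [T]
    · right; right; simp [T]
    · right; right; simp [T]
    · right; left; exact subset_rfl
  have himg : ∀ (_ : DecidableEq (F1 ⊕ (F1 ⊕ F2))) (S S' : Finset (F1 ⊕ (F1 ⊕ F2))),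
      matroidRank M ((S ∪ S').image dupProj) + matroidRank M ((S ∩ S').image dupProj) ≤
        matroidRank M (S.image dupProj) + matroidRank M (S'.image dupProj) := by
    intro _ S S'
    rw [image_union]
    have h1 := matroidRank_mono M (image_inter_subset (dupProj : F1 ⊕ (F1 ⊕ F2) → F1 ⊕ F2) S S')
    have h2 := matroidRank_submod M (S.image dupProj) (S'.image dupProj)
    omega
  obtain ⟨Z, z0, z1, z2, z3, z4⟩ := submod_laminar_round
    (fun S : Finset (F1 ⊕ (F1 ⊕ F2)) => (m : ℤ) * (matroidRank M (S.image dupProj) : ℤ))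
    (by
      have := matroidRank_le_card M (∅ : Finset (F1 ⊕ F2))
      simp at this ⊢
      simp [this])
    (by
      intro S S'
      have := himg (fun a b => Classical.propDecidable (a = b)) S S'
      rw [← mul_add, ← mul_add]
      exact mul_le_mul_of_nonneg_left (by exact_mod_cast this) (by positivity))
    T hlam
    (Sum.elim lo (Sum.elim (fun S => ℓ S.1) (fun b => if b then lb else lb1)))
    (Sum.elim hi (Sum.elim (fun S => u S.1) (fun b => if b then ub else ub1)))
    W Y hY0 (by intro S; push_cast; exact hYr S)
    (by
      rintro (a | S | _ | _)
      · simpa [T, sum_disjSum] using hX a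
      · simpa [T, sum_disjSum] using (hYL _ S.2).1
      · simpa [T, sum_disjSum] using hY1
      · simpa [T] using hY)
    (by
      rintro (a | S | _ | _)
      · simpa [T, sum_disjSum] using hX' a
      · simpa [T, sum_disjSum] using (hYL _ S.2).2
      · simpa [T, sum_disjSum] using hY1'
      · simpa [T] using hY')
  refine ⟨Z, z0, z1, ?_, ?_, ?_, ?_, ?_, ?_, ?_, z4⟩
  · intro S hS
    have a1 := z2 (Sum.inr (Sum.inl ⟨S, hS⟩))
    have a2 := z3 (Sum.inr (Sum.inl ⟨S, hS⟩))
    simp only [T, sum_disjSum, Sum.elim_inl, Sum.elim_inr, sum_empty, zero_add] at a1 a2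
    exact ⟨a1, a2⟩
  · have := z2 (Sum.inr (Sum.inr false)); simpa [T, sum_disjSum] using this
  · have := z3 (Sum.inr (Sum.inr false)); simpa [T, sum_disjSum] using this
  · have := z2 (Sum.inr (Sum.inr true)); simpa [T] using this
  · have := z3 (Sum.inr (Sum.inr true)); simpa [T] using this
  · intro a; have := z2 (Sum.inl a); simpa [T, sum_disjSum] using this
  · intro a; have := z3 (Sum.inl a); simpa [T, sum_disjSum] using this

lemma dup_extract {F1 F2 : Type*} [Fintype F1] [Fintype F2] (M : Matroid (F1 ⊕ F2))
    (h : F1 ⊕ (F1 ⊕ F2) → ℤ) (h0 : ∀ e, 0 ≤ h e)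
    (hr : ∀ S : Finset (F1 ⊕ (F1 ⊕ F2)), ∑ e ∈ S, h e ≤ (matroidRank M (S.image dupProj) : ℤ)) :
    ∃ Fs : Finset (F1 ⊕ F2), M.Indep ↑Fs ∧
      (∀ S : Finset F2, ((S.filter (fun i => Sum.inr i ∈ Fs)).card : ℤ) =
        ∑ i ∈ S, h (Sum.inr (Sum.inr i))) ∧
      ((Fs.filter (fun i => i.isLeft)).card : ℤ) =
        ∑ i : F1, h (Sum.inl i) + ∑ i : F1, h (Sum.inr (Sum.inl i)) ∧
      (Fs.card : ℤ) = ∑ e, h e ∧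
      (∀ i, 0 < h (Sum.inl i) → Sum.inl i ∈ Fs) ∧
      (∀ f : F1 ⊕ F2 → ℝ, ∑ i ∈ Fs, f i = ∑ e, f (dupProj e) * h e) := by
  set g : F1 ⊕ F2 → ℤ := Sum.elim (fun i => h (Sum.inl i) + h (Sum.inr (Sum.inl i)))
    (fun i => h (Sum.inr (Sum.inr i))) with hg
  have g0 : ∀ b, 0 ≤ g b := by
    rintro (i | i)
    · exact add_nonneg (h0 _) (h0 _)
    · exact h0 _
  have hgS : ∀ S : Finset (F1 ⊕ F2), ∑ b ∈ S, g b ≤ matroidRank M S := by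
    intro S
    have h1 := hr (univ.filter (fun e => dupProj e ∈ S))
    have h2 : (univ.filter (fun e : F1 ⊕ (F1 ⊕ F2) => dupProj e ∈ S)).image dupProj ⊆ S := by
      intro b hb
      obtain ⟨e, he, rfl⟩ := mem_image.1 hb
      exact (mem_filter.1 he).2
    have h3 := matroidRank_mono M h2
    have h4 : ∑ b ∈ S, g b = ∑ e ∈ univ.filter (fun e => dupProj e ∈ S), h e := by
      rw [sum_filter, Fintype.sum_sum_type, Fintype.sum_sum_type, ← add_assoc, ← sum_add_distrib]
      have : ∑ b ∈ S, g b = ∑ b, if b ∈ S then g b else 0 := by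
        rw [← sum_filter]; simp
      rw [this, Fintype.sum_sum_type]
      congr 1
      refine sum_congr rfl fun i _ => ?_
      by_cases hi : Sum.inl i ∈ S <;> simp [dupProj, hg, hi]
    rw [h4]
    refine h1.trans ?_
    exact_mod_cast h3
  have g1 : ∀ b, g b ≤ 1 := by
    intro b
    have a1 := hgS {b}
    have a2 := matroidRank_le_card M {b}
    simp only [sum_singleton, card_singleton] at a1 a2
    refine a1.trans ?_
    exact_mod_cast a2
  set Fs := univ.filter (fun b => g b = 1) with hFs
  have hmem : ∀ b, b ∈ Fs ↔ g b = 1 := by intro b; simp [hFs]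
  have hgi : ∀ b, g b = if b ∈ Fs then 1 else 0 := by
    intro b
    have := g0 b
    have := g1 b
    by_cases hb : g b = 1
    · rw [if_pos ((hmem b).2 hb), hb]
    · rw [if_neg (fun h => hb ((hmem b).1 h))]; omega
  refine ⟨Fs, ?_, ?_, ?_, ?_, ?_, ?_⟩
  · apply indep_of_card_le_matroidRank
    have h1 := hgS Fs
    have h2 : ∑ b ∈ Fs, g b = Fs.card := by
      rw [sum_congr rfl (fun b hb => (hmem b).1 hb)]; simp
    rw [h2] at h1
    exact_mod_cast h1
  · intro S
    have : ∀ i : F2, h (Sum.inr (Sum.inr i)) = if Sum.inr i ∈ Fs then 1 else 0 := fun i =>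
      hgi (Sum.inr i)
    simp only [this]
    simp
  · have : ∑ i : F1, h (Sum.inl i) + ∑ i : F1, h (Sum.inr (Sum.inl i)) = ∑ i : F1, g (Sum.inl i) := by
      rw [← sum_add_distrib]; rfl
    rw [this]
    have h2 : ((Fs.filter (fun i => i.isLeft)).card : ℤ) =
        ∑ b, if b ∈ Fs ∧ b.isLeft then (1 : ℤ) else 0 := by
      rw [← sum_filter]; simp [hFs, filter_filter]
    rw [h2, Fintype.sum_sum_type]
    simp [hgi]
  · have : ∑ e, h e = ∑ b, g b := by
      rw [Fintype.sum_sum_type, Fintype.sum_sum_type, Fintype.sum_sum_type, ← add_assoc,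
        ← sum_add_distrib]
      rfl
    rw [this]
    simp [hgi]
  · intro i hi
    rw [hmem]
    have a1 := g1 (Sum.inl i)
    have a2 := h0 (Sum.inr (Sum.inl i))
    simp only [hg, Sum.elim_inl] at a1 ⊢
    omega
  · intro f
    have : ∑ i ∈ Fs, f i = ∑ b, f b * g b := by
      have : ∀ b, f b * (g b : ℝ) = if b ∈ Fs then f b else 0 := by
        intro b; rw [hgi b]; split_ifs <;> simp
      simp only [this]
      simp
    rw [this, Fintype.sum_sum_type, Fintype.sum_sum_type, Fintype.sum_sum_type, ← add_assoc,
        ← sum_add_distrib]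
    congr 1
    refine sum_congr rfl fun i _ => ?_
    simp only [hg, dupProj, Sum.elim_inl, Sum.elim_inr, id]
    push_cast; ring

lemma cluster_data {A J : Type*} [Fintype A] [Fintype J] (cF : A → J → ℝ) (cJ : J → J → ℝ)
    (hF0 : ∀ i j, 0 ≤ cF i j)
    (C : J → ℝ) (hC0 : ∀ j, 0 ≤ C j) (hsep : ∀ j k, j ≠ k → 4 * max (C j) (C k) < cJ j k) :
    ∃ (σ : J → J) (γ : J → ℝ), (∀ j, 0 < γ j) ∧ (∀ j k, j ≠ k → 2 * γ j ≤ cJ j k) ∧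
      ∀ j, (σ j ≠ j ∧ cJ j (σ j) = 2 * γ j ∧ 2 * C j < γ j) ∨ (∀ i, cF i j < γ j) := by
  have : ∀ j, ∃ (s : J) (g : ℝ), 0 < g ∧ (∀ k, j ≠ k → 2 * g ≤ cJ j k) ∧
      ((s ≠ j ∧ cJ j s = 2 * g ∧ 2 * C j < g) ∨ (∀ i, cF i j < g)) := by
    intro j
    by_cases hj : ∃ k, k ≠ j
    · obtain ⟨k, hk⟩ := hj
      obtain ⟨s, hs, hmin⟩ := (univ.filter (fun k => k ≠ j)).exists_min_image (cJ j)
        ⟨k, by simpa using hk⟩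
      simp only [mem_filter, mem_univ, true_and] at hs hmin
      have h1 := hsep j s (Ne.symm hs)
      have h2 := le_max_left (C j) (C s)
      have h3 := hC0 j
      refine ⟨s, cJ j s / 2, by linarith, fun k hk => ?_, Or.inl ⟨hs, by ring, by linarith⟩⟩
      have := hmin k (Ne.symm hk)
      linarith
    · push Not at hj
      refine ⟨j, 1 + ∑ i, cF i j, ?_, fun k hk => absurd (hj k) (Ne.symm hk), Or.inr fun i => ?_⟩
      · have := sum_nonneg (s := univ) (f := fun i => cF i j) (fun i _ => hF0 i j)
        linarith
      · have := single_le_sum (s := univ) (f := fun i => cF i j) (fun i _ => hF0 i j) (mem_univ i)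
        linarith
  choose σ γ h1 h2 h3 using this
  exact ⟨σ, γ, h1, h2, h3⟩

lemma dup_split_le {F1 F2 : Type*} [Fintype F1] [Fintype F2] (M : Matroid (F1 ⊕ F2))
    (y : F1 ⊕ F2 → ℝ) (hrank : ∀ S : Finset (F1 ⊕ F2), ∑ i ∈ S, y i ≤ (matroidRank M S : ℝ))
    (Y : F1 ⊕ (F1 ⊕ F2) → ℝ) (hY0 : ∀ e, 0 ≤ Y e)
    (hl : ∀ i, Y (Sum.inl i) + Y (Sum.inr (Sum.inl i)) = y (Sum.inl i))
    (hr : ∀ i, Y (Sum.inr (Sum.inr i)) = y (Sum.inr i)) (S : Finset (F1 ⊕ (F1 ⊕ F2))) :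
    ∑ e ∈ S, Y e ≤ (matroidRank M (S.image dupProj) : ℝ) := by
  refine le_trans ?_ (hrank (S.image dupProj))
  have h4 : ∑ b ∈ S.image dupProj, y b =
      ∑ e ∈ univ.filter (fun e => dupProj e ∈ S.image dupProj), Y e := by
    rw [sum_filter, Fintype.sum_sum_type, Fintype.sum_sum_type, ← add_assoc, ← sum_add_distrib]
    generalize S.image dupProj = S'
    have : ∑ b ∈ S', y b = ∑ b, if b ∈ S' then y b else 0 := by
      rw [← sum_filter]; simp
    rw [this, Fintype.sum_sum_type]
    congr 1
    · refine sum_congr rfl fun i _ => ?_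
      by_cases hi : Sum.inl i ∈ S' <;> simp [dupProj, hi, hl]
    · refine sum_congr rfl fun i _ => ?_
      by_cases hi : Sum.inr i ∈ S' <;> simp [dupProj, hi, hr]
  rw [h4]
  apply sum_le_sum_of_subset_of_nonneg
  · intro e he
    simp only [mem_filter, mem_univ, true_and]
    exact mem_image_of_mem _ he
  · intro e _ _; exact hY0 e

set_option maxHeartbeats 4000000 in
/-- Any fractional solution to the laminarity-constrained matroid median
problem can be rounded to an integral solution of cost at most 8 times
larger. -/
theorem laminarity_constrained_matroid_median_8
    {F1 F2 D : Type*} [Fintype F1] [Fintype F2] [Fintype D]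
    (c : F1 ⊕ D → F1 ⊕ D → ℝ)
    (hc_nonneg : ∀ u v, 0 ≤ c u v)
    (hc_symm : ∀ u v, c u v = c v u)
    (hc_tri : ∀ u v w, c u w ≤ c u v + c v w)
    (f : F1 ⊕ F2 → ℝ) (hf : ∀ i, 0 ≤ f i)
    (d : D → ℝ) (hd : ∀ j, 0 ≤ d j)
    (M : Matroid (F1 ⊕ F2)) (hME : M.E = Set.univ)
    (L : Set (Finset F2))
    (hlaminar : ∀ S ∈ L, ∀ T ∈ L, Disjoint S T ∨ S ⊆ T ∨ T ⊆ S)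
    (ℓ u : Finset F2 → ℤ)
    (hℓu : ∀ S ∈ L, 0 ≤ ℓ S ∧ ℓ S ≤ u S)
    (lb1 ub1 lb ub : ℤ)
    (hb1 : lb1 ≤ ub1) (hb : lb ≤ ub)
    (x : F1 → D → ℝ) (y : F1 ⊕ F2 → ℝ)
    (hx : ∀ i j, 0 ≤ x i j) (hy : ∀ i, 0 ≤ y i)
    (hx1 : ∀ j, 1 ≤ ∑ i, x i j)
    (hxy : ∀ i j, x i j ≤ y (Sum.inl i))
    (hrank : ∀ S : Finset (F1 ⊕ F2), ∑ i ∈ S, y i ≤ (matroidRank M S : ℝ))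
    (hlam_lb : ∀ S ∈ L, (ℓ S : ℝ) ≤ ∑ i ∈ S, y (Sum.inr i))
    (hlam_ub : ∀ S ∈ L, ∑ i ∈ S, y (Sum.inr i) ≤ (u S : ℝ))
    (hlb1 : (lb1 : ℝ) ≤ ∑ i : F1, y (Sum.inl i))
    (hub1 : ∑ i : F1, y (Sum.inl i) ≤ (ub1 : ℝ))
    (hlb : (lb : ℝ) ≤ ∑ i, y i) (hub : ∑ i, y i ≤ (ub : ℝ)) :
    ∃ (Fs : Finset (F1 ⊕ F2)) (σ : D → F1),
      M.Indep ↑Fs ∧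
      (∀ S ∈ L, ℓ S ≤ ((S.filter (fun i => Sum.inr i ∈ Fs)).card : ℤ) ∧
        ((S.filter (fun i => Sum.inr i ∈ Fs)).card : ℤ) ≤ u S) ∧
      lb1 ≤ ((Fs.filter (fun i => i.isLeft)).card : ℤ) ∧
      ((Fs.filter (fun i => i.isLeft)).card : ℤ) ≤ ub1 ∧
      lb ≤ (Fs.card : ℤ) ∧ (Fs.card : ℤ) ≤ ub ∧
      (∀ j, Sum.inl (σ j) ∈ Fs) ∧
      (∑ i ∈ Fs, f i) + ∑ j, d j * c (Sum.inl (σ j)) (Sum.inr j) ≤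
        8 * ((∑ i, f i * y i) +
          ∑ j, ∑ i : F1, d j * c (Sum.inl i) (Sum.inr j) * x i j) := by
  -- normalised assignment
  set s : D → ℝ := fun j => ∑ i, x i j with hs
  have hs1 : ∀ j, 1 ≤ s j := hx1
  set x' : F1 → D → ℝ := fun i j => x i j / s j with hx'
  have hx'0 : ∀ i j, 0 ≤ x' i j := fun i j => div_nonneg (hx i j) (by linarith [hs1 j])
  have hx'le : ∀ i j, x' i j ≤ x i j := fun i j => div_le_self (hx i j) (hs1 j)
  have hx'1 : ∀ j, ∑ i, x' i j = 1 := by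
    intro j
    simp only [hx', ← sum_div]
    exact div_self (by linarith [hs1 j])
  set C : D → ℝ := fun j => ∑ i, c (Sum.inl i) (Sum.inr j) * x' i j with hC
  have hC0 : ∀ j, 0 ≤ C j := fun j => sum_nonneg fun i _ => mul_nonneg (hc_nonneg _ _) (hx'0 i j)
  have hCle : ∀ j, C j ≤ ∑ i, c (Sum.inl i) (Sum.inr j) * x i j := fun j =>
    sum_le_sum fun i _ => mul_le_mul_of_nonneg_left (hx'le i j) (hc_nonneg _ _)
  -- consolidation of the demands
  obtain ⟨D', -, hpair, hcov⟩ := greedy_reps C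
    (fun j k => c (Sum.inr j) (Sum.inr k) ≤ 4 * max (C j) (C k))
    (fun j k h => by rw [hc_symm, max_comm]; exact h) _ (univ : Finset D) le_rfl
  have hrep : ∀ j, ∃ k : D', ((k : D) = j ∨ c (Sum.inr j) (Sum.inr (k : D)) ≤ 4 * C j) ∧
      C k ≤ C j := by
    intro j
    obtain ⟨k, hk, h1, h2⟩ := hcov j (mem_univ _)
    refine ⟨⟨k, hk⟩, ?_, h2⟩
    rcases h1 with h1 | h1
    · exact Or.inl h1
    · right; rw [max_eq_left h2] at h1; exact h1
  choose rep hrep1 hrep2 using hrep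
  set cF : F1 → D' → ℝ := fun i j => c (Sum.inl i) (Sum.inr (j : D)) with hcF
  set cJ : D' → D' → ℝ := fun j k => c (Sum.inr (j : D)) (Sum.inr (k : D)) with hcJ
  obtain ⟨σ, γ, hγ0, hγ, hσ⟩ := cluster_data cF cJ (fun i j => hc_nonneg _ _) (fun j => C j)
    (fun j => hC0 j) (fun j k hjk => by
      have := hpair j j.2 k k.2 (fun h => hjk (Subtype.ext h))
      exact not_le.1 this)
  set G : D' → Finset F1 := fun j => univ.filter (fun i => cF i j < γ j) with hG
  have hGm : ∀ j i, i ∈ G j ↔ cF i j < γ j := by intro j i; simp [hG]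
  have hGd : ∀ j k i, i ∈ G j → i ∈ G k → j = k := by
    intro j k i hj hk
    by_contra hne
    have h1 := (hGm j i).1 hj
    have h2 := (hGm k i).1 hk
    have h3 := hγ j k hne
    have h4 := hγ k j (Ne.symm hne)
    have h5 : cJ j k ≤ cF i j + cF i k := by
      have := hc_tri (Sum.inr (j : D)) (Sum.inl i) (Sum.inr (k : D))
      rw [hc_symm (Sum.inr (j : D)) (Sum.inl i)] at this
      exact this
    have : cJ j k = cJ k j := hc_symm _ _
    linarith
  set xG : D' → ℝ := fun j => ∑ i ∈ G j, x' i j with hxG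
  have hxGc : ∀ j, xG j + ∑ i ∈ (G j)ᶜ, x' i j = 1 := fun j => by
    rw [hxG, ← hx'1 j]; exact sum_add_sum_compl _ _
  have hxGle : ∀ j, xG j ≤ 1 := fun j => by
    have := hxGc j
    have := sum_nonneg (s := (G j)ᶜ) (f := fun i => x' i j) (fun i _ => hx'0 i j)
    linarith
  have hfracC : ∀ j, ∑ i ∈ G j, cF i j * x' i j + γ j * (1 - xG j) ≤ C j := by
    intro j
    have h1 : C j = ∑ i ∈ G j, cF i j * x' i j + ∑ i ∈ (G j)ᶜ, cF i j * x' i j :=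
      (sum_add_sum_compl _ _).symm
    have h2 : γ j * ∑ i ∈ (G j)ᶜ, x' i j ≤ ∑ i ∈ (G j)ᶜ, cF i j * x' i j := by
      rw [mul_sum]
      refine sum_le_sum fun i hi => mul_le_mul_of_nonneg_right ?_ (hx'0 i j)
      rw [mem_compl, hGm] at hi
      exact not_lt.1 hi
    have h3 := hxGc j
    have h4 : 1 - xG j = ∑ i ∈ (G j)ᶜ, x' i j := by linarith
    rw [h1, h4]
    linarith
  have hcxnn : ∀ j : D', 0 ≤ ∑ i ∈ G j, cF i j * x' i j := fun j =>
    sum_nonneg fun i _ => mul_nonneg (hc_nonneg _ _) (hx'0 i j)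
  set LB : D' → ℤ := fun j => if (∀ i, cF i j < γ j) then 2 else 1 with hLB
  have hLBx : ∀ j, (LB j : ℝ) ≤ 2 * xG j := by
    intro j
    by_cases h : ∀ i, cF i j < γ j
    · have : G j = univ := by ext i; simp [hGm, h]
      simp only [hLB, if_pos h, hxG, this, hx'1]
      norm_num
    · obtain ⟨-, -, h3⟩ := (hσ j).resolve_right h
      simp only [hLB, if_neg h]
      have h4 := hfracC j
      have h5 := hcxnn j
      have h6 := hγ0 j
      push_cast
      by_contra hcon
      push Not at hcon
      have : γ j * (1 / 2) < γ j * (1 - xG j) := mul_lt_mul_of_pos_left (by linarith) h6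
      linarith
  -- the split point
  have ha : ∃ a : F1 → ℝ, (∀ i, 0 ≤ a i) ∧ (∀ i, a i ≤ y (Sum.inl i)) ∧
      ∀ j, ∀ i ∈ G j, a i = x' i j := by
    refine ⟨fun i => if h : ∃ j, i ∈ G j then x' i h.choose else 0, ?_, ?_, ?_⟩
    · intro i; dsimp only; split_ifs with h
      · exact hx'0 _ _
      · exact le_rfl
    · intro i; dsimp only; split_ifs with h
      · exact (hx'le _ _).trans (hxy _ _)
      · exact hy _
    · intro j i hi
      have h : ∃ j, i ∈ G j := ⟨j, hi⟩
      dsimp only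
      rw [dif_pos h, hGd _ _ i h.choose_spec hi]
  obtain ⟨a, ha0, hay, haG⟩ := ha
  set Y : F1 ⊕ (F1 ⊕ F2) → ℝ := Sum.elim a
    (Sum.elim (fun i => y (Sum.inl i) - a i) (fun i => y (Sum.inr i))) with hYdef
  have hY0 : ∀ e, 0 ≤ Y e := by
    rintro (i | i | i)
    · exact ha0 i
    · exact sub_nonneg.2 (hay i)
    · exact hy _
  have hYr := dup_split_le M y hrank Y hY0 (fun i => by simp [hYdef]) (fun i => rfl)
  have hY1 : ∑ i : F1, Y (Sum.inl i) + ∑ i : F1, Y (Sum.inr (Sum.inl i)) = ∑ i : F1, y (Sum.inl i) := by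
    rw [← sum_add_distrib]; exact sum_congr rfl fun i _ => by simp [hYdef]
  have hYt : ∑ e, Y e = ∑ b, y b := by
    rw [Fintype.sum_sum_type, Fintype.sum_sum_type, Fintype.sum_sum_type, ← add_assoc, hY1]
    rfl
  have hYf : ∑ e, f (dupProj e) * Y e = ∑ b, f b * y b := by
    rw [Fintype.sum_sum_type, Fintype.sum_sum_type, Fintype.sum_sum_type, ← add_assoc,
      ← sum_add_distrib]
    congr 1
    refine sum_congr rfl fun i _ => ?_
    simp only [hYdef, dupProj, Sum.elim_inl, Sum.elim_inr, id]
    ring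
  have hYG : ∀ j, ∑ i ∈ G j, Y (Sum.inl i) = xG j := fun j => sum_congr rfl (haG j)
  -- a linear functional on the first copies
  set W1 : F1 → ℝ := fun i => ∑ j, d j * (if i ∈ G (rep j) then
    2 * cF i (rep j) - 4 * γ (rep j) else 0) with hW1
  have hW1s : ∀ t : F1 → ℝ, ∑ i, W1 i * t i = ∑ j, d j *
      (2 * ∑ i ∈ G (rep j), cF i (rep j) * t i - 4 * γ (rep j) * ∑ i ∈ G (rep j), t i) := by
    intro t
    simp only [hW1, sum_mul]
    rw [sum_comm]
    refine sum_congr rfl fun j _ => ?_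
    have : ∀ i, d j * (if i ∈ G (rep j) then 2 * cF i (rep j) - 4 * γ (rep j) else 0) * t i =
        if i ∈ G (rep j) then d j * (2 * (cF i (rep j) * t i) - 4 * γ (rep j) * t i) else 0 := by
      intro i; split_ifs <;> ring
    simp only [this]
    rw [sum_ite_mem, univ_inter, ← mul_sum, sum_sub_distrib, ← mul_sum, ← mul_sum]
  obtain ⟨Z, z0, zr, zL, z1, z1', zt, zt', zlo, zhi, zc⟩ := dup_round M L hlaminar 2
    (fun S => 2 * ℓ S) (fun S => 2 * u S) (2 * lb1) (2 * ub1) (2 * lb) (2 * ub) G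
    (fun j k hjk => Finset.disjoint_left.2 fun i h h' => hjk (hGd j k i h h')) LB (fun _ => 2)
    (fun e => f (dupProj e) + Sum.elim W1 (fun _ => 0) e) (fun e => 2 * Y e)
    (fun e => by have := hY0 e; linarith)
    (fun S => by
      have := hYr S
      rw [← mul_sum]; push_cast; linarith)
    (fun S hS => by
      have a1 := hlam_lb S hS
      have a2 := hlam_ub S hS
      rw [← mul_sum]; push_cast
      have : ∑ i ∈ S, Y (Sum.inr (Sum.inr i)) = ∑ i ∈ S, y (Sum.inr i) := rfl
      rw [this]
      exact ⟨by linarith, by linarith⟩)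
    (by rw [← mul_sum, ← mul_sum, ← mul_add, hY1]; push_cast; linarith)
    (by rw [← mul_sum, ← mul_sum, ← mul_add, hY1]; push_cast; linarith)
    (by rw [← mul_sum, hYt]; push_cast; linarith)
    (by rw [← mul_sum, hYt]; push_cast; linarith)
    (fun j => by rw [← mul_sum, hYG]; exact hLBx j)
    (fun j => by rw [← mul_sum, hYG]; push_cast; linarith [hxGle j])
  have hsplit : ∀ (W : F1 → ℝ) (t : F1 ⊕ (F1 ⊕ F2) → ℝ),
      ∑ e, (f (dupProj e) + Sum.elim W (fun _ => 0) e) * t e =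
        ∑ e, f (dupProj e) * t e + ∑ i, W i * t (Sum.inl i) := by
    intro W t
    simp only [add_mul, sum_add_distrib]
    congr 1
    rw [Fintype.sum_sum_type]
    simp
  rw [hsplit, hsplit, hW1s, hW1s] at zc
  -- clusters of the half-integral solution
  obtain ⟨D2, S, b, p, q, hSd, hS2, hopen, hb, hpq⟩ := half_integral_clusters cF cJ
    (fun i j => hc_nonneg _ _) (fun j k => hc_symm _ _) (fun i j k => hc_tri _ _ _)
    (fun i j k => by
      have := hc_tri (Sum.inr (j : D)) (Sum.inl i) (Sum.inr (k : D))
      rw [hc_symm (Sum.inr (j : D)) (Sum.inl i)] at this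
      exact this)
    γ (fun j => (hγ0 j).le) hγ G (fun j i hi => (hGm j i).1 hi) σ (fun i => Z (Sum.inl i))
    (fun i => z0 _)
    (fun j => by
      have h1 := zlo j
      have h2 := zhi j
      by_cases h : ∀ i, cF i j < γ j
      · simp only [hLB, if_pos h] at h1
        left; omega
      · obtain ⟨a1, a2, a3⟩ := (hσ j).resolve_right h
        simp only [hLB, if_neg h] at h1
        by_cases h3 : ∑ i ∈ G j, Z (Sum.inl i) = 2
        · exact Or.inl h3
        · right; exact ⟨by omega, a1, a2⟩)
  set W2 : F1 → ℝ := fun i => ∑ j, d j * (if b (rep j) = i then p (rep j) - q (rep j) else 0) with hW2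
  have hW2s : ∀ t : F1 → ℝ, ∑ i, W2 i * t i =
      ∑ j, d j * ((p (rep j) - q (rep j)) * t (b (rep j))) := by
    intro t
    simp only [hW2, sum_mul]
    rw [sum_comm]
    refine sum_congr rfl fun j _ => ?_
    rw [Fintype.sum_eq_single (b (rep j))]
    · simp; ring
    · intro i hi
      rw [if_neg (Ne.symm hi)]; ring
  obtain ⟨h, h0, hr, hL, h1, h1', ht, ht', hlo, -, hcost⟩ := dup_round M L hlaminar 1
    ℓ u lb1 ub1 lb ub (fun j : D2 => S j)
    (fun j k hjk => hSd j j.2 k k.2 (fun h => hjk (Subtype.ext h))) (fun _ => 1)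
    (fun j => ⌈∑ i ∈ S j, (Z (Sum.inl i) : ℝ) / 2⌉)
    (fun e => f (dupProj e) + Sum.elim W2 (fun _ => 0) e) (fun e => (Z e : ℝ) / 2)
    (fun e => by have : (0 : ℝ) ≤ Z e := by exact_mod_cast z0 e
                 linarith)
    (fun T => by
      have : (∑ e ∈ T, (Z e : ℝ)) ≤ 2 * (matroidRank M (T.image dupProj) : ℝ) := by
        exact_mod_cast zr T
      rw [← sum_div]; push_cast; linarith)
    (fun T hT => by
      obtain ⟨a1, a2⟩ := zL T hT
      have a1' : 2 * (ℓ T : ℝ) ≤ ∑ i ∈ T, (Z (Sum.inr (Sum.inr i)) : ℝ) := by exact_mod_cast a1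
      have a2' : ∑ i ∈ T, (Z (Sum.inr (Sum.inr i)) : ℝ) ≤ 2 * (u T : ℝ) := by exact_mod_cast a2
      rw [← sum_div]
      exact ⟨by linarith, by linarith⟩)
    (by
      have a1 : 2 * (lb1 : ℝ) ≤ ∑ i : F1, (Z (Sum.inl i) : ℝ) + ∑ i : F1, (Z (Sum.inr (Sum.inl i)) : ℝ) := by
        exact_mod_cast z1
      rw [← sum_div, ← sum_div]; linarith)
    (by
      have a1 : ∑ i : F1, (Z (Sum.inl i) : ℝ) + ∑ i : F1, (Z (Sum.inr (Sum.inl i)) : ℝ) ≤ 2 * (ub1 : ℝ) := by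
        exact_mod_cast z1'
      rw [← sum_div, ← sum_div]; linarith)
    (by
      have a1 : 2 * (lb : ℝ) ≤ ∑ e, (Z e : ℝ) := by exact_mod_cast zt
      rw [← sum_div]; linarith)
    (by
      have a1 : ∑ e, (Z e : ℝ) ≤ 2 * (ub : ℝ) := by exact_mod_cast zt'
      rw [← sum_div]; linarith)
    (fun j => by
      have a1 : (2 : ℝ) ≤ ∑ i ∈ S j, (Z (Sum.inl i) : ℝ) := by exact_mod_cast hS2 j j.2
      rw [← sum_div]; push_cast; linarith)
    (fun j => Int.le_ceil _)
  rw [hsplit, hsplit, hW2s, hW2s] at hcost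
  obtain ⟨Fs, hind, hFL, hF1, hFt, hFm, hFf⟩ := dup_extract M h h0 (fun T => by
    have := hr T; simpa using this)
  -- assignment of the representatives
  have hassign : ∀ k : D', ∃ i, Sum.inl i ∈ Fs ∧
      cF i k ≤ q k + (p k - q k) * (h (Sum.inl (b k)) : ℝ) := by
    intro k
    obtain ⟨o1, o2⟩ := hopen (fun i => h (Sum.inl i)) (fun i => h0 _)
      (fun j hj => hlo ⟨j, hj⟩) k
    have hle1 : h (Sum.inl (b k)) ≤ 1 := by
      have a1 := hr {Sum.inl (b k)}
      have a2 := matroidRank_le_card M (({Sum.inl (b k)} : Finset (F1 ⊕ (F1 ⊕ F2))).image dupProj)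
      simp only [sum_singleton, image_singleton, card_singleton, Nat.cast_one, one_mul] at a1 a2
      refine a1.trans ?_
      exact_mod_cast a2
    have := h0 (Sum.inl (b k))
    rcases (by omega : h (Sum.inl (b k)) = 0 ∨ h (Sum.inl (b k)) = 1) with e | e
    · obtain ⟨i, hi, hi'⟩ := o2 e
      exact ⟨i, hFm i hi, by rw [e]; simpa using hi'⟩
    · obtain ⟨i, hi, hi'⟩ := o1 (by omega)
      exact ⟨i, hFm i hi, by rw [e]; simpa using hi'⟩
  choose τ hτ1 hτ2 using hassign
  refine ⟨Fs, fun j => τ (rep j), hind, fun T hT => ?_, ?_, ?_, ?_, ?_, fun j => hτ1 _, ?_⟩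
  · rw [hFL]; exact hL T hT
  · rw [hF1]; exact h1
  · rw [hF1]; exact h1'
  · rw [hFt]; exact ht
  · rw [hFt]; exact ht'
  -- final cost computation
  rw [hFf f]
  have c1 : ∀ j, d j * c (Sum.inl (τ (rep j))) (Sum.inr j) ≤
      d j * (4 * C j) + d j * q (rep j) +
        d j * ((p (rep j) - q (rep j)) * (h (Sum.inl (b (rep j))) : ℝ)) := by
    intro j
    have a1 : c (Sum.inl (τ (rep j))) (Sum.inr j) ≤ 4 * C j + cF (τ (rep j)) (rep j) := by
      rcases hrep1 j with e | e
      · have : cF (τ (rep j)) (rep j) = c (Sum.inl (τ (rep j))) (Sum.inr j) := by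
          simp only [hcF, e]
        rw [this]; linarith [hC0 j]
      · have := hc_tri (Sum.inl (τ (rep j))) (Sum.inr (rep j : D)) (Sum.inr j)
        rw [hc_symm (Sum.inr (rep j : D))] at this
        have e2 : cF (τ (rep j)) (rep j) = c (Sum.inl (τ (rep j))) (Sum.inr (rep j : D)) := rfl
        linarith
    have a2 := hτ2 (rep j)
    rw [← mul_add, ← mul_add]
    exact mul_le_mul_of_nonneg_left (by linarith) (hd j)
  have c2 : ∀ j, d j * q (rep j) + d j * ((p (rep j) - q (rep j)) * ((Z (Sum.inl (b (rep j))) : ℝ) / 2)) ≤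
      d j * (∑ i ∈ G (rep j), cF i (rep j) * Z (Sum.inl i) +
        2 * γ (rep j) * (2 - ∑ i ∈ G (rep j), (Z (Sum.inl i) : ℝ))) := by
    intro j
    rw [← mul_add]
    refine mul_le_mul_of_nonneg_left ?_ (hd j)
    refine le_trans (le_of_eq ?_) (hpq (rep j))
    rcases hb (rep j) with e | e
    · rw [e]; push_cast; ring
    · rw [e]; ring
  have c3 : ∀ j, d j * (2 * ∑ i ∈ G (rep j), cF i (rep j) * (2 * Y (Sum.inl i)) -
      4 * γ (rep j) * ∑ i ∈ G (rep j), (2 * Y (Sum.inl i))) + d j * (8 * γ (rep j)) ≤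
      d j * (8 * C j) := by
    intro j
    rw [← mul_add]
    refine mul_le_mul_of_nonneg_left ?_ (hd j)
    have e1 : ∑ i ∈ G (rep j), cF i (rep j) * (2 * Y (Sum.inl i)) =
        2 * ∑ i ∈ G (rep j), cF i (rep j) * x' i (rep j) := by
      rw [mul_sum]
      refine sum_congr rfl fun i hi => ?_
      have : Y (Sum.inl i) = x' i (rep j) := haG _ i hi
      rw [this]; ring
    rw [e1, ← mul_sum, hYG]
    have := hfracC (rep j)
    have := hcxnn (rep j)
    have := hrep2 j
    have := mul_nonneg (hγ0 (rep j)).le (sub_nonneg.2 (hxGle (rep j)))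
    nlinarith
  have c4 : ∀ j, d j * C j ≤ ∑ i : F1, d j * c (Sum.inl i) (Sum.inr j) * x i j := by
    intro j
    have := mul_le_mul_of_nonneg_left (hCle j) (hd j)
    refine this.trans (le_of_eq ?_)
    rw [mul_sum]
    exact sum_congr rfl fun i _ => by ring
  have s1 := sum_le_sum fun j (_ : j ∈ (univ : Finset D)) => c1 j
  have s2 := sum_le_sum fun j (_ : j ∈ (univ : Finset D)) => c2 j
  have s3 := sum_le_sum fun j (_ : j ∈ (univ : Finset D)) => c3 j
  have s4 := sum_le_sum fun j (_ : j ∈ (univ : Finset D)) => c4 j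
  have e4 : ∑ j, d j * (4 * C j) = 4 * ∑ j, d j * C j := by
    rw [mul_sum]; exact sum_congr rfl fun j _ => by ring
  have e8 : ∑ j, d j * (8 * C j) = 8 * ∑ j, d j * C j := by
    rw [mul_sum]; exact sum_congr rfl fun j _ => by ring
  have eZ : 2 * ∑ j, d j * (∑ i ∈ G (rep j), cF i (rep j) * Z (Sum.inl i) +
        2 * γ (rep j) * (2 - ∑ i ∈ G (rep j), (Z (Sum.inl i) : ℝ))) =
      ∑ j, d j * (2 * ∑ i ∈ G (rep j), cF i (rep j) * Z (Sum.inl i) -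
        4 * γ (rep j) * ∑ i ∈ G (rep j), (Z (Sum.inl i) : ℝ)) + ∑ j, d j * (8 * γ (rep j)) := by
    rw [mul_sum, ← sum_add_distrib]; exact sum_congr rfl fun j _ => by ring
  have eY : ∑ e, f (dupProj e) * (2 * Y e) = 2 * ∑ b, f b * y b := by
    rw [← hYf, mul_sum]; exact sum_congr rfl fun e _ => by ring
  have eH : ∑ e, f (dupProj e) * ((Z e : ℝ) / 2) = (∑ e, f (dupProj e) * (Z e : ℝ)) / 2 := by
    rw [sum_div]; exact sum_congr rfl fun e _ => by ring
  have hfy : 0 ≤ ∑ b, f b * y b := sum_nonneg fun b _ => mul_nonneg (hf b) (hy b)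
  simp only [sum_add_distrib] at s1 s2 s3
  rw [e4] at s1
  rw [e8] at s3
  rw [eY] at zc
  rw [eH] at hcost
  have s2' : ∑ j, d j * q (rep j) +
      ∑ j, d j * ((p (rep j) - q (rep j)) * ((Z (Sum.inl (b (rep j))) : ℝ) / 2)) ≤
      ∑ j, d j * (∑ i ∈ G (rep j), cF i (rep j) * Z (Sum.inl i) +
        2 * γ (rep j) * (2 - ∑ i ∈ G (rep j), (Z (Sum.inl i) : ℝ))) := s2
  linarith
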